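/- arXiv:2007.14760 — 10 statements merged into one kernel-verified Lean document; each statement's English description precedes it below -/
import Mathlib

section
/- Let K be a field of characteristic 0, let n, d ≥ 1 be natural numbers, and let f be a homogeneous multivariate polynomial of degree d in variables indexed by Fin n over K. Let P : Fin n → K with f(P) ≠ 0, and let S ⊆ (Fin n → K) be a set of points such that for every Q ∈ S and every t ∈ K one has f(P + t·Q) = f(P). Then S is contained in the kernel of the nonzero linear functional x ↦ ∑_i x_i·(∂f/∂x_i)(P); in particular the K-linear span of S is a proper subspace of Fin n → K (i.e. Submodule.span K S ≠ ⊤). -/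
open MvPolynomial

/-- Chain rule for substituting univariate polynomials into a multivariate polynomial. -/
theorem derivative_aeval_eq_sum {R σ : Type*} [CommSemiring R] [Fintype σ]
    (g : σ → Polynomial R) (f : MvPolynomial σ R) :
    Polynomial.derivative (aeval g f) =
      ∑ i, Polynomial.derivative (g i) * aeval g (pderiv i f) := by
  classical
  induction f using MvPolynomial.induction_on with
  | C a => simp [Polynomial.algebraMap_eq]
  | add p q hp hq => simp [hp, hq, mul_add, Finset.sum_add_distrib]
  | mul_X p j hp =>
    simp only [map_mul, aeval_X, Polynomial.derivative_mul, hp, pderiv_mul, pderiv_X, map_add,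
      mul_add, Finset.sum_add_distrib, Finset.sum_mul, mul_assoc]
    congr 1
    simp [Pi.single_apply, apply_ite (aeval g), mul_comm]

/-- A polynomial over an infinite domain that is constant along the line through `P` in the
direction `Q` has vanishing directional derivative at `P` along `Q`. -/
theorem sum_mul_eval_pderiv_eq_zero_of_line_constant {R σ : Type*} [CommRing R] [IsDomain R]
    [Infinite R] [Fintype σ] (f : MvPolynomial σ R) (P Q : σ → R)
    (h : ∀ t : R, eval (P + t • Q) f = eval P f) :
    ∑ i, Q i * eval P (pderiv i f) = 0 := by
  let g : σ → Polynomial R := fun i => Polynomial.C (P i) + Polynomial.C (Q i) * Polynomial.X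
  have eval_line (t : R) (p : MvPolynomial σ R) :
      (aeval g p).eval t = eval (P + t • Q) p := by
    have hg : (fun i => Polynomial.aeval t (g i)) = P + t • Q := by
      ext i
      simp [g, mul_comm t]
    rw [← Polynomial.coe_aeval_eq_eval, comp_aeval_apply, hg, aeval_eq_eval]
  have hconst : aeval g f = Polynomial.C (eval P f) :=
    Polynomial.funext fun t => by rw [eval_line, h, Polynomial.eval_C]
  have hder := congrArg (Polynomial.eval 0) (derivative_aeval_eq_sum g f)
  rw [hconst, Polynomial.derivative_C, Polynomial.eval_zero, Polynomial.eval_finsetSum] at hder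
  simp only [Polynomial.eval_mul, eval_line] at hder
  simpa [g] using hder.symm

/-- The core degeneracy argument: if `f(P) ≠ 0` and `f` is constant along every affine
line `t ↦ P + t • Q` with direction `Q ∈ S`, then `S` lies in the kernel of the nonzero
linear functional `x ↦ ∑ i, x i * (∂f/∂xᵢ)(P)`; in particular `S` spans a proper
subspace of `Fin n → K`. -/
theorem span_ne_top_of_line_constant {K : Type*} [Field K] [CharZero K]
    {n d : ℕ} (hn : 1 ≤ n) (hd : 1 ≤ d)
    (f : MvPolynomial (Fin n) K) (hf : f.IsHomogeneous d)
    (P : Fin n → K) (hP : MvPolynomial.eval P f ≠ 0)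
    (S : Set (Fin n → K))
    (hS : ∀ Q ∈ S, ∀ t : K, MvPolynomial.eval (P + t • Q) f = MvPolynomial.eval P f) :
    (∃ i : Fin n, MvPolynomial.eval P (MvPolynomial.pderiv i f) ≠ 0) ∧
    (∀ Q ∈ S, ∑ i, Q i * MvPolynomial.eval P (MvPolynomial.pderiv i f) = 0) ∧
    Submodule.span K S ≠ ⊤ := by
  have euler : ∑ i, P i * eval P (pderiv i f) = d * eval P f := by
    simpa using congrArg (eval P) hf.sum_X_mul_pderiv
  have hne : ∑ i, P i * eval P (pderiv i f) ≠ 0 := by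
    rw [euler]
    exact mul_ne_zero (Nat.cast_ne_zero.mpr (by lia)) hP
  have hker : ∀ Q ∈ S, ∑ i, Q i * eval P (pderiv i f) = 0 := fun Q hQ =>
    sum_mul_eval_pderiv_eq_zero_of_line_constant f P Q (hS Q hQ)
  refine ⟨?_, hker, fun htop => hne ?_⟩
  · obtain ⟨i, -, hi⟩ := Finset.exists_ne_zero_of_sum_ne_zero hne
    exact ⟨i, right_ne_zero_of_mul hi⟩
  · let φ := Fintype.linearCombination K fun i => eval P (pderiv i f)
    have hle : Submodule.span K S ≤ LinearMap.ker φ := Submodule.span_le.mpr fun Q hQ => by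
      simpa [φ, Fintype.linearCombination_apply] using hker Q hQ
    have hPφ : φ P = 0 := hle (htop ▸ Submodule.mem_top)
    simpa [φ, Fintype.linearCombination_apply] using hPφ
end

section
/- Let K be an algebraically closed field of characteristic 0, let n, d ≥ 1 be natural numbers, and let f be a homogeneous multivariate polynomial of degree d in variables indexed by Fin n over K. Let P : Fin n → K with f(P) ≠ 0, and let S ⊆ (Fin n → K) be a set whose K-linear span is all of Fin n → K. Then there exist Q ∈ S and a scalar t ∈ K with t ≠ 0 such that f(P + t·Q) = 0. -/
open MvPolynomial

/-- The chain rule for substituting univariate polynomials into a multivariate one. -/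
theorem MvPolynomial.derivative_aeval_eq_sum_pderiv {R σ : Type*} [CommRing R] [Fintype σ]
    (g : σ → Polynomial R) (f : MvPolynomial σ R) :
    Polynomial.derivative (aeval g f) =
      ∑ i, aeval g (pderiv i f) * Polynomial.derivative (g i) := by
  classical
  induction f using MvPolynomial.induction_on with
  | C a => simp [Polynomial.algebraMap_eq]
  | add p q hp hq => simp [hp, hq, add_mul, Finset.sum_add_distrib]
  | mul_X p j hp =>
    simp only [map_mul, aeval_X, Polynomial.derivative_mul, hp, Derivation.leibniz, pderiv_X,
      smul_eq_mul, map_add, add_mul, Finset.sum_add_distrib, Finset.sum_mul]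
    rw [add_comm]
    refine congrArg₂ (· + ·) ?_ ?_
    · simp [Pi.single_apply, apply_ite (aeval g)]
    · exact Finset.sum_congr rfl fun i _ => by ring

/-- If a polynomial has no zero on the line through `P` in direction `Q`, then its directional
derivative at `P` along `Q` vanishes. -/
theorem MvPolynomial.sum_pderiv_mul_eq_zero_of_eval_line_ne_zero {K σ : Type*} [Field K]
    [IsAlgClosed K] [Fintype σ] (f : MvPolynomial σ K) (P Q : σ → K)
    (h : ∀ t : K, eval (P + t • Q) f ≠ 0) :
    ∑ i, eval P (pderiv i f) * Q i = 0 := by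
  set g : σ → Polynomial K := fun i => Polynomial.C (P i) + Polynomial.X * Polynomial.C (Q i)
    with hg
  have eval_line (t : K) (p : MvPolynomial σ K) :
      (aeval g p).eval t = eval (P + t • Q) p := by
    rw [← Polynomial.coe_evalRingHom, MvPolynomial.aeval_def, MvPolynomial.hom_eval₂,
      MvPolynomial.eval, MvPolynomial.coe_eval₂Hom]
    congr 1
    · ext; simp
    · ext i; simp [hg, mul_comm t (Q i)]
  have hdeg : (aeval g f).degree = 0 := by
    by_contra hne
    obtain ⟨t, ht⟩ := IsAlgClosed.exists_root _ hne
    exact h t (by rw [← eval_line]; exact ht)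
  have hder : Polynomial.derivative (aeval g f) = 0 := by
    rw [Polynomial.eq_C_of_degree_eq_zero hdeg, Polynomial.derivative_C]
  have := congrArg (Polynomial.eval 0) hder
  simpa [derivative_aeval_eq_sum_pderiv, Polynomial.eval_finsetSum, eval_line,
    show ∀ i, Polynomial.derivative (g i) = Polynomial.C (Q i) by simp [hg]] using this

/-- If the set of directions `S` spans the whole space, then some affine line through a
point `P` with `f(P) ≠ 0`, in a direction `Q ∈ S`, meets the hypersurface `{f = 0}`
away from `P`. -/
theorem exists_zero_on_line_of_span_eq_top {K : Type*} [Field K] [IsAlgClosed K]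
    [CharZero K] {n d : ℕ} (hn : 1 ≤ n) (hd : 1 ≤ d)
    (f : MvPolynomial (Fin n) K) (hf : f.IsHomogeneous d)
    (P : Fin n → K) (hP : MvPolynomial.eval P f ≠ 0)
    (S : Set (Fin n → K)) (hS : Submodule.span K S = ⊤) :
    ∃ Q ∈ S, ∃ t : K, t ≠ 0 ∧ MvPolynomial.eval (P + t • Q) f = 0 := by
  by_contra! hcon
  let L : (Fin n → K) →ₗ[K] K := dotProductBilin K K fun i => eval P (pderiv i f)
  have hL : L = 0 := LinearMap.ext_on hS fun Q hQ =>
    sum_pderiv_mul_eq_zero_of_eval_line_ne_zero f P Q fun t => by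
      rcases eq_or_ne t 0 with rfl | ht
      · simpa using hP
      · exact hcon Q hQ t ht
  have hLP : ∑ i, eval P (pderiv i f) * P i = 0 := LinearMap.congr_fun hL P
  have euler := congrArg (eval P) hf.sum_X_mul_pderiv
  simp only [map_sum, map_mul, eval_X, mul_comm (P _), hLP, nsmul_eq_mul, map_natCast] at euler
  exact mul_ne_zero (Nat.cast_ne_zero.2 (Nat.one_le_iff_ne_zero.1 hd)) hP euler.symm
end

section
/- Let K be an algebraically closed field of characteristic 0 and let N ≥ 1. Let Z ⊆ (Fin (N+1) → K) be a cone (i.e. c·z ∈ Z for all c ∈ K and z ∈ Z) whose K-linear span is all of Fin (N+1) → K, and let f be a nonzero homogeneous multivariate polynomial over K in variables indexed by Fin (N+1) that vanishes on Z (so Z is contained in the hypersurface W = {x | f(x) = 0}). Let P : Fin (N+1) → K satisfy f(P) ≠ 0, and assume P cannot be written as a sum x + y of two elements x, y ∈ Z. Then there exist Q ∈ Z with Q ≠ 0 and a point R : Fin (N+1) → K such that: f(R) = 0, R ∉ Z, P lies in the K-linear span of {Q, R}, and moreover every point of the K-linear span of {P, Q} that belongs to Z is a scalar multiple of Q (the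 line through P and Q meets Z in one projective point only and meets W∖Z in at least another point). -/
open MvPolynomial

/-- Evaluating the restriction of `f` to a parametrized line. -/
theorem eval_aeval_line {K σ : Type*} [CommRing K] (f : MvPolynomial σ K) (P Q : σ → K)
    (t : K) :
    (aeval (fun i => Polynomial.C (P i) + Polynomial.C (Q i) * Polynomial.X) f).eval t =
      eval (P + t • Q) f := by
  induction f using MvPolynomial.induction_on with
  | C a => simp
  | add p q hp hq => simp [hp, hq]
  | mul_X p i hp => simp [hp, mul_comm t]

/-- The derivative at `0` of `t ↦ f (P + t Q)` is the differential of `f` at `P` applied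
to `Q`. -/
theorem eval_zero_derivative_aeval_line {K σ : Type*} [CommRing K] [Fintype σ]
    (f : MvPolynomial σ K) (P Q : σ → K) :
    (Polynomial.derivative (aeval
      (fun i => Polynomial.C (P i) + Polynomial.C (Q i) * Polynomial.X) f)).eval 0 =
      ∑ i, Q i * eval P (pderiv i f) := by
  classical
  induction f using MvPolynomial.induction_on with
  | C a => simp
  | add p q hp hq => simp [hp, hq, mul_add, Finset.sum_add_distrib]
  | mul_X p i hp =>
    have h : ∀ j, Q j * eval P (pderiv j (p * X i)) =
        (if j = i then Q j * eval P p else 0) + Q j * eval P (pderiv j p) * P i := by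
      intro j
      by_cases hj : j = i
      · subst hj
        simp
        ring
      · simp [pderiv_X_of_ne (Ne.symm hj), hj]
        ring
    rw [Finset.sum_congr rfl fun j _ => h j]
    simp [hp, eval_aeval_line, Finset.sum_add_distrib, Finset.sum_mul]
    ring

/-- If the directions in `Z` span the space, a homogeneous polynomial of positive degree
vanishes somewhere on some line through `P` with direction in `Z`. -/
theorem exists_mem_eval_add_smul_eq_zero {K σ : Type*} [Field K] [IsAlgClosed K] [CharZero K]
    [Fintype σ] {Z : Set (σ → K)} (hspan : Submodule.span K Z = ⊤)
    {f : MvPolynomial σ K} {d : ℕ} (hd : d ≠ 0) (hf : f.IsHomogeneous d)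
    {P : σ → K} (hP : eval P f ≠ 0) :
    ∃ Q ∈ Z, ∃ t : K, eval (P + t • Q) f = 0 := by
  by_contra! hne
  have hdiff : ∀ Q ∈ Z, ∑ i, Q i * eval P (pderiv i f) = 0 := by
    intro Q hQ
    have hdeg : (aeval (fun i => Polynomial.C (P i) + Polynomial.C (Q i) * Polynomial.X)
        f).degree = 0 := by
      by_contra h
      obtain ⟨t, ht⟩ := IsAlgClosed.exists_root _ h
      exact hne Q hQ t (by rw [← eval_aeval_line]; exact ht)
    rw [← eval_zero_derivative_aeval_line, Polynomial.eq_C_of_degree_eq_zero hdeg]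
    simp
  have hlin : ∀ x ∈ Submodule.span K Z, ∑ i, x i * eval P (pderiv i f) = 0 := by
    intro x hx
    induction hx using Submodule.span_induction with
    | mem x hx => exact hdiff x hx
    | zero => simp
    | add x y _ _ hx hy => simp [add_mul, Finset.sum_add_distrib, hx, hy]
    | smul c x _ hx => simp [mul_assoc, ← Finset.mul_sum, hx]
  have hEuler := hlin P (hspan ▸ Submodule.mem_top)
  have := congrArg (eval P) hf.sum_X_mul_pderiv
  simp [hEuler, hd, hP] at this

/-- Affine-cone formulation of Proposition 1: if `Z` is a non-degenerate cone contained
in the hypersurface `W = {f = 0}`, `P` lies outside `W` and is not a sum of two elements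
of `Z` (rank ≠ 2), then some line through `P` meets `Z` in one projective point `Q` only
and meets `W ∖ Z` in at least another point `R`. -/
theorem cone_section_reducible {K : Type*} [Field K] [IsAlgClosed K] [CharZero K]
    {N : ℕ} (hN : 1 ≤ N) {d : ℕ}
    (Z : Set (Fin (N + 1) → K))
    (hcone : ∀ (c : K), ∀ z ∈ Z, c • z ∈ Z)
    (hspan : Submodule.span K Z = ⊤)
    (f : MvPolynomial (Fin (N + 1)) K) (hf0 : f ≠ 0) (hf : f.IsHomogeneous d)
    (hZW : ∀ z ∈ Z, MvPolynomial.eval z f = 0)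
    (P : Fin (N + 1) → K) (hP : MvPolynomial.eval P f ≠ 0)
    (hrank : ¬ ∃ x ∈ Z, ∃ y ∈ Z, P = x + y) :
    ∃ Q ∈ Z, Q ≠ 0 ∧ ∃ R : Fin (N + 1) → K,
      MvPolynomial.eval R f = 0 ∧ R ∉ Z ∧
      P ∈ Submodule.span K ({Q, R} : Set (Fin (N + 1) → K)) ∧
      ∀ x ∈ Submodule.span K ({P, Q} : Set (Fin (N + 1) → K)),
        x ∈ Z → ∃ c : K, x = c • Q := by
  have hd : d ≠ 0 := by
    rintro rfl
    obtain ⟨a, rfl⟩ : ∃ a, f = C a := ⟨_, totalDegree_eq_zero_iff_eq_C.mp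
      (Nat.le_zero.mp hf.totalDegree_le)⟩
    have hZ : Z = ∅ := Set.eq_empty_of_forall_notMem fun z hz => by
      have := hZW z hz
      simp_all
    rw [hZ, Submodule.span_empty] at hspan
    exact bot_ne_top hspan
  obtain ⟨Q, hQ, t, ht⟩ := exists_mem_eval_add_smul_eq_zero hspan hd hf hP
  refine ⟨Q, hQ, ?_, P + t • Q, ht, ?_, ?_, ?_⟩
  · rintro rfl
    exact hP (by simpa using ht)
  · intro hR
    exact hrank ⟨_, hR, _, hcone (-t) Q hQ, by simp⟩
  · exact Submodule.mem_span_pair.mpr ⟨-t, 1, by module⟩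
  · intro x hx hxZ
    obtain ⟨a, b, rfl⟩ := Submodule.mem_span_pair.mp hx
    by_cases ha : a = 0
    · exact ⟨b, by simp [ha]⟩
    · refine absurd ⟨_, hcone a⁻¹ _ hxZ, _, hcone (-(a⁻¹ * b)) Q hQ, ?_⟩ hrank
      rw [smul_add, smul_smul, smul_smul, inv_mul_cancel₀ ha]
      module
end

section
/- Let K be an algebraically closed field of characteristic 0 and let N ≥ 1. Let f be an irreducible homogeneous multivariate polynomial over K in variables indexed by Fin (N+1), and suppose that its zero set Z = {x : Fin (N+1) → K | f(x) = 0} spans Fin (N+1) → K as a K-vector space (i.e. the hypersurface is non-degenerate). Then every point P : Fin (N+1) → K can be written as P = x + y with x, y ∈ Z; consequently the maximum X-rank with respect to the hypersurface X = {f = 0} equals 2. -/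
open MvPolynomial

namespace MvPolynomial

variable {σ R : Type*} [CommSemiring R]

theorem IsHomogeneous.eval_smul_eq {f : MvPolynomial σ R} {d : ℕ} (hf : f.IsHomogeneous d)
    (r : R) (x : σ → R) : eval (r • x) f = r ^ d * eval x f := by
  simp only [eval_eq, Finset.mul_sum]
  refine Finset.sum_congr rfl fun m hm => ?_
  have hdeg : ∑ i ∈ m.support, m i = d := (hf.degree_eq_sum_deg_support hm).symm
  simp only [Pi.smul_apply, smul_eq_mul, mul_pow, Finset.prod_mul_distrib,
    Finset.prod_pow_eq_pow_sum, hdeg]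
  ring

/-- The restriction of a polynomial to the parametrized line `s ↦ P + s • q`. -/
noncomputable def restrictLine (P q : σ → R) : MvPolynomial σ R →ₐ[R] Polynomial R :=
  aeval fun i => Polynomial.C (P i) + Polynomial.X * Polynomial.C (q i)

theorem restrictLine_X (P q : σ → R) (i : σ) :
    restrictLine P q (X i) = Polynomial.C (P i) + Polynomial.X * Polynomial.C (q i) := by
  simp [restrictLine]

theorem eval_restrictLine (P q : σ → R) (f : MvPolynomial σ R) (s : R) :
    (restrictLine P q f).eval s = eval (P + s • q) f := by
  induction f using MvPolynomial.induction_on with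
  | C a => simp [restrictLine]
  | add f g hf hg => simp [hf, hg]
  | mul_X f i hf => simp [hf, restrictLine_X, mul_comm s]

theorem eval_derivative_restrictLine [Fintype σ] (P q : σ → R) (f : MvPolynomial σ R) :
    (Polynomial.derivative (restrictLine P q f)).eval 0 = ∑ i, q i * eval P (pderiv i f) := by
  classical
  induction f using MvPolynomial.induction_on with
  | C a => simp [restrictLine]
  | add f g hf hg => simp [hf, hg, mul_add, Finset.sum_add_distrib]
  | mul_X f i hf =>
    simp only [map_mul, Polynomial.derivative_mul, Polynomial.eval_add, Polynomial.eval_mul, hf,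
      eval_restrictLine, restrictLine_X, pderiv_mul, pderiv_X, map_add, mul_add, Finset.sum_add_distrib]
    simp [Finset.sum_mul, Pi.single_apply, apply_ite, mul_assoc, mul_comm (q i)]

end MvPolynomial


/-- Proposition 2: the affine cone over a non-degenerate irreducible hypersurface
`X = {f = 0} ⊂ ℙ^N` has the property that every point of the ambient space is the sum
of two of its points, i.e. the maximum `X`-rank is `2`. -/
theorem hypersurface_max_rank_two {K : Type*} [Field K] [IsAlgClosed K] [CharZero K]
    {N : ℕ} (hN : 1 ≤ N) {d : ℕ}
    (f : MvPolynomial (Fin (N + 1)) K) (hirr : Irreducible f) (hf : f.IsHomogeneous d)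
    (hspan :
      Submodule.span K {x : Fin (N + 1) → K | MvPolynomial.eval x f = 0} = ⊤) :
    ∀ P : Fin (N + 1) → K,
      ∃ x ∈ {x : Fin (N + 1) → K | MvPolynomial.eval x f = 0},
        ∃ y ∈ {x : Fin (N + 1) → K | MvPolynomial.eval x f = 0}, P = x + y := by
  intro P
  simp only [Set.mem_ofPred_eq]
  have hd : d ≠ 0 := by
    rintro rfl
    rw [← totalDegree_zero_iff_isHomogeneous, totalDegree_eq_zero_iff_eq_C] at hf
    have hc : coeff 0 f ≠ 0 := fun h => hirr.ne_zero (by rw [hf, h, C_0])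
    exact hirr.not_isUnit (hf ▸ hc.isUnit.map C)
  have hcone (r : K) (x : Fin (N + 1) → K) (hx : eval x f = 0) : eval (r • x) f = 0 := by
    rw [hf.eval_smul_eq, hx, mul_zero]
  by_contra! hP
  have hfP : eval P f ≠ 0 := fun h =>
    hP P h 0 (by simpa [hd] using hf.eval_smul_eq 0 0) (add_zero P).symm
  let ℓ : (Fin (N + 1) → K) →ₗ[K] K :=
    Fintype.linearCombination K fun i => eval P (pderiv i f)
  have hℓ (q : Fin (N + 1) → K) : ℓ q = ∑ i, q i * eval P (pderiv i f) := by
    simp [ℓ, Fintype.linearCombination_apply]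
  have hker : {x | eval x f = 0} ⊆ (LinearMap.ker ℓ : Set (Fin (N + 1) → K)) := by
    intro q hq
    have hdeg : (restrictLine P q f).degree = 0 := by
      by_contra h
      obtain ⟨s, hs⟩ := IsAlgClosed.exists_root _ h
      rw [Polynomial.IsRoot, eval_restrictLine] at hs
      exact hP _ hs _ (hcone (-s) q hq) (by simp)
    rw [SetLike.mem_coe, LinearMap.mem_ker, hℓ, ← eval_derivative_restrictLine,
      Polynomial.eq_C_of_degree_eq_zero hdeg]
    simp
  have hℓP : ℓ P = 0 := by
    have htop : ⊤ ≤ LinearMap.ker ℓ := hspan ▸ Submodule.span_le.mpr hker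
    exact htop Submodule.mem_top
  have heuler : ℓ P = d * eval P f := by
    simpa [hℓ] using congrArg (eval P) hf.sum_X_mul_pderiv
  exact mul_ne_zero (Nat.cast_ne_zero.mpr hd) hfP (heuler.symm.trans hℓP)
end

section
/- Work in the ℂ-module M = ExteriorAlgebra ℂ (Fin 3 → ℂ) ⊗[ℂ] (Fin 3 → ℂ), and for v, w, u : Fin 3 → ℂ write v∧w⊗u for (ι v * ι w) ⊗ₜ u, where ι is the canonical inclusion into the exterior algebra; let e₁, e₂, e₃ be the standard basis of Fin 3 → ℂ. Then for all a, b, c, d ∈ ℂ there exist v₁, w₁, v₂, w₂ : Fin 3 → ℂ such that a·(e₁∧e₂⊗e₁) + b·(e₁∧e₂⊗e₂) + c·(e₁∧e₃⊗e₁) + d·(e₂∧e₃⊗e₁ − e₁∧e₂⊗e₃) = v₁∧w₁⊗v₁ + v₂∧w₂⊗v₂. -/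
open TensorProduct

/-- Every point of the affine cone over the tangent space to the flag variety
`F(0,1;2)` at `e₁∧e₂⊗e₁` is a sum of two points of the cone over `F(0,1;2)`. -/
theorem tangent_space_flag_rank_two
    (ι : (Fin 3 → ℂ) →ₗ[ℂ] ExteriorAlgebra ℂ (Fin 3 → ℂ))
    (hι : ι = ExteriorAlgebra.ι ℂ)
    (e : Fin 3 → (Fin 3 → ℂ)) (he : ∀ i, e i = Pi.single i 1)
    (a b c d : ℂ) :
    ∃ v₁ w₁ v₂ w₂ : Fin 3 → ℂ,
      a • ((ι (e 0) * ι (e 1)) ⊗ₜ[ℂ] e 0) +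
      b • ((ι (e 0) * ι (e 1)) ⊗ₜ[ℂ] e 1) +
      c • ((ι (e 0) * ι (e 2)) ⊗ₜ[ℂ] e 0) +
      d • ((ι (e 1) * ι (e 2)) ⊗ₜ[ℂ] e 0 - (ι (e 0) * ι (e 1)) ⊗ₜ[ℂ] e 2) =
      (ι v₁ * ι w₁) ⊗ₜ[ℂ] v₁ + (ι v₂ * ι w₂) ⊗ₜ[ℂ] v₂ := by
  subst hι
  have hsq (v : Fin 3 → ℂ) : ExteriorAlgebra.ι ℂ v * ExteriorAlgebra.ι ℂ v = 0 :=
    ExteriorAlgebra.ι_sq_zero v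
  have hanti (v w : Fin 3 → ℂ) :
      ExteriorAlgebra.ι ℂ v * ExteriorAlgebra.ι ℂ w =
        -(ExteriorAlgebra.ι ℂ w * ExteriorAlgebra.ι ℂ v) :=
    eq_neg_of_add_eq_zero_left (ExteriorAlgebra.ι_add_mul_swap v w)
  by_cases hd : d = 0
  · refine ⟨e 0, a • e 1 + c • e 2, e 1, (-b) • e 0, ?_⟩
    simp only [hd, map_add, map_smul, mul_add, mul_smul_comm, add_tmul, ← smul_tmul',
      hanti (e 1) (e 0), neg_tmul]
    module
  · -- Under `v ∧ w ↦ det (v, w, ·)` the left-hand side is an endomorphism of `ℂ³` with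
    -- eigenvectors `e 0`, `x`, `k` for the eigenvalues `d`, `-d`, `0`.
    obtain ⟨x, hx⟩ : ∃ x, x = (-(a + b * c / d) / (2 * d)) • e 0 + (-b / d) • e 1 + e 2 :=
      ⟨_, rfl⟩
    obtain ⟨k, hk⟩ : ∃ k, k = (c / d) • e 0 + e 1 := ⟨_, rfl⟩
    refine ⟨e 0 + x, (-d / 2) • k, e 0 - x, (d / 2) • k, ?_⟩
    simp only [hx, hk, map_add, map_sub, map_smul, mul_add, add_mul, sub_mul, smul_mul_assoc,
      mul_smul_comm, add_tmul, sub_tmul, tmul_add, tmul_sub, tmul_smul, ← smul_tmul', hsq,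
      hanti (e 1) (e 0), hanti (e 2) (e 0), hanti (e 2) (e 1), neg_tmul, zero_tmul]
    match_scalars <;> field_simp <;> ring
end

section
/- Work in the ℂ-module M = ExteriorAlgebra ℂ (Fin 3 → ℂ) ⊗[ℂ] (Fin 3 → ℂ), and for v, w, u : Fin 3 → ℂ write v∧w⊗u for (ι v * ι w) ⊗ₜ u, where ι is the canonical inclusion into the exterior algebra. Let D = {v∧w⊗v | v, w : Fin 3 → ℂ} ⊆ M. Then every element x of the ℂ-linear span of D can be written as a sum of at most three elements of D: there exist v₁, w₁, v₂, w₂, v₃, w₃ : Fin 3 → ℂ with x = v₁∧w₁⊗v₁ + v₂∧w₂⊗v₂ + v₃∧w₃⊗v₃. -/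
/-- A basis of a hyperplane `ker φ` extends, by a vector on which `φ` is `1`, to a basis of the
whole space; its coordinates are `φ` and the old coordinates of the projection to `ker φ`. -/
theorem Module.Basis.exists_cons_of_ker {K V : Type*} [Field K] [AddCommGroup V] [Module K V]
    {n : ℕ} (φ : Module.Dual K V) (v : V) (hv : φ v = 1) (c : Module.Basis (Fin n) K φ.ker)
    (π : V →ₗ[K] φ.ker) (hπ : ∀ x, (π x : V) = x - φ x • v) :
    ∃ b : Module.Basis (Fin (n + 1)) K V, b 0 = v ∧ (∀ i, b i.succ = c i) ∧
      b.coord 0 = φ ∧ ∀ i, b.coord i.succ = c.coord i ∘ₗ π := by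
  let b := Module.Basis.mkFinCons v c
    (fun a x hx h => by
      have h' := congrArg φ h
      rw [LinearMap.mem_ker] at hx
      simpa [hv, hx] using h')
    (fun z => ⟨-φ z, by simp [hv]⟩)
  have h0 : b 0 = v := by simp [b]
  have hs : ∀ i : Fin n, b i.succ = c i := fun i => by simp [b]
  have hπv : π v = 0 := Subtype.ext (by simp [hπ, hv])
  have hπc : ∀ i, π (c i) = c i := fun i => Subtype.ext (by
    rw [hπ, LinearMap.mem_ker.1 (c i).2, zero_smul, sub_zero])
  refine ⟨b, h0, hs, b.ext fun j => ?_, fun i => b.ext fun j => ?_⟩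
  · refine Fin.cases ?_ (fun j => ?_) j
    · rw [Module.Basis.coord_apply, Module.Basis.repr_self, h0, hv]
      simp
    · rw [Module.Basis.coord_apply, Module.Basis.repr_self, hs, LinearMap.mem_ker.1 (c j).2]
      simp
  · refine Fin.cases ?_ (fun j => ?_) j
    · rw [Module.Basis.coord_apply, Module.Basis.repr_self, h0]
      simp [hπv]
    · rw [Module.Basis.coord_apply, Module.Basis.repr_self, hs]
      simp [hπc, Finsupp.single_apply]

theorem LinearMap.trace_eq_sum_coord {K V : Type*} [Field K] [AddCommGroup V] [Module K V]
    {n : ℕ} (b : Module.Basis (Fin n) K V) (f : V →ₗ[K] V) :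
    LinearMap.trace K V f = ∑ i, b.coord i (f (b i)) := by
  simp [LinearMap.trace_eq_matrix_trace K b, Matrix.trace, LinearMap.toMatrix_apply]

/-- In characteristic zero, an endomorphism of trace zero has zero diagonal in some basis. -/
theorem LinearMap.exists_basis_coord_apply_eq_zero_of_trace_eq_zero {K : Type*} [Field K]
    [CharZero K] (n : ℕ) : ∀ {V : Type*} [AddCommGroup V] [Module K V] [FiniteDimensional K V]
      (_ : Module.finrank K V = n) (f : V →ₗ[K] V) (_ : LinearMap.trace K V f = 0),
      ∃ b : Module.Basis (Fin n) K V, ∀ i, b.coord i (f (b i)) = 0 := by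
  induction n with
  | zero =>
    intro V _ _ _ hV f _
    exact ⟨Module.finBasisOfFinrankEq K V hV, fun i => i.elim0⟩
  | succ n ih =>
    intro V _ _ _ hV f hf
    by_cases h : ∀ v, ¬ LinearIndependent K ![v, f v]
    · obtain ⟨a, rfl⟩ := f.exists_eq_smul_id_of_forall_notLinearIndependent h
      have ha : a = 0 := by
        have hn : (n : K) + 1 ≠ 0 := by exact_mod_cast n.succ_ne_zero
        simpa [hV, hn] using hf
      exact ⟨Module.finBasisOfFinrankEq K V hV, fun i => by simp [ha]⟩
    · push Not at h
      obtain ⟨v, hv⟩ := h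
      have hmem : v ∉ Submodule.span K {f v} := by
        intro hmem
        obtain ⟨a, ha⟩ := Submodule.mem_span_singleton.1 hmem
        have := (LinearIndependent.pair_iff.1 hv) 1 (-a) (by simp [ha])
        exact one_ne_zero this.1
      obtain ⟨ψ, hψ, hψf⟩ := Submodule.exists_dual_map_eq_bot_of_notMem hmem inferInstance
      have hψf : ψ (f v) = 0 := by
        rw [← Submodule.mem_bot K, ← hψf]
        exact Submodule.mem_map_of_mem (Submodule.mem_span_singleton_self _)
      obtain ⟨φ, hφv, hφf⟩ : ∃ φ : Module.Dual K V, φ v = 1 ∧ φ (f v) = 0 :=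
        ⟨(ψ v)⁻¹ • ψ, by simp [hψ], by simp [hψf]⟩
      have hφ : φ ≠ 0 := by rintro rfl; simp at hφv
      let π : V →ₗ[K] φ.ker :=
        (LinearMap.id - φ.smulRight v).codRestrict φ.ker (fun x => by simp [hφv])
      have hπ : ∀ x, (π x : V) = x - φ x • v := fun _ => rfl
      have hW : Module.finrank K φ.ker = n := by
        have := Module.Dual.finrank_ker_add_one_of_ne_zero hφ
        omega
      have htr : LinearMap.trace K φ.ker (π ∘ₗ f ∘ₗ φ.ker.subtype) = 0 := by
        obtain ⟨b, h0, hs, hc0, hcs⟩ := Module.Basis.exists_cons_of_ker φ v hφv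
          (Module.finBasisOfFinrankEq K φ.ker hW) π hπ
        rw [LinearMap.trace_eq_sum_coord b, Fin.sum_univ_succ, h0, hc0, hφf, zero_add] at hf
        rw [LinearMap.trace_eq_sum_coord (Module.finBasisOfFinrankEq K φ.ker hW), ← hf]
        exact Finset.sum_congr rfl fun i _ => by rw [hcs, hs]; rfl
      obtain ⟨c, hc⟩ := ih hW _ htr
      obtain ⟨b, h0, hs, hc0, hcs⟩ := Module.Basis.exists_cons_of_ker φ v hφv c π hπ
      refine ⟨b, Fin.cases ?_ fun i => ?_⟩
      · rw [h0, hc0, hφf]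
      · rw [hs, hcs]
        exact hc i

/-- The identification of `K³` with `⋀² K³` that turns the cross product into the
exterior product. -/
noncomputable def bivector (K : Type*) [CommRing K] :
    (Fin 3 → K) →ₗ[K] ExteriorAlgebra K (Fin 3 → K) :=
  Fintype.linearCombination K fun i : Fin 3 =>
    ExteriorAlgebra.ι K (Pi.single (i + 1) 1) * ExteriorAlgebra.ι K (Pi.single (i + 2) 1)

theorem bivector_crossProduct {K : Type*} [CommRing K] (v w : Fin 3 → K) :
    bivector K (crossProduct v w) = ExteriorAlgebra.ι K v * ExteriorAlgebra.ι K w := by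
  have expand (u : Fin 3 → K) : ExteriorAlgebra.ι K u =
      ∑ i, u i • ExteriorAlgebra.ι K (Pi.single i 1) := by
    simp_rw [← map_smul, ← map_sum, ← Pi.single_smul, smul_eq_mul, mul_one,
      Finset.univ_sum_single]
  obtain ⟨e, he⟩ : ∃ e : Fin 3 → ExteriorAlgebra K (Fin 3 → K),
      ∀ i, ExteriorAlgebra.ι K (Pi.single i 1) = e i := ⟨_, fun _ => rfl⟩
  have sq (i : Fin 3) : e i * e i = 0 := by rw [← he, ExteriorAlgebra.ι_sq_zero]
  have swap (i j : Fin 3) : e i * e j = -(e j * e i) := by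
    rw [← he, ← he]
    exact eq_neg_of_add_eq_zero_left (ExteriorAlgebra.ι_add_mul_swap _ _)
  simp only [bivector, Fintype.linearCombination_apply, cross_apply, expand v, expand w, he,
    Fin.sum_univ_three, add_mul, mul_add, smul_mul_smul_comm, sq, smul_zero]
  rw [swap 1 0, swap 2 1, swap 0 2]
  simp
  module

theorem exists_crossProduct_eq {K : Type*} [Field K] {v p : Fin 3 → K} (hv : v ≠ 0)
    (h : p ⬝ᵥ v = 0) : ∃ w, crossProduct v w = p := by
  obtain ⟨i, hi⟩ := Function.ne_iff.1 hv
  refine ⟨crossProduct p (Pi.single i (v i)⁻¹), ?_⟩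
  rw [cross_cross_eq_smul_sub_smul', h, dotProduct_single, mul_inv_cancel₀ hi]
  simp

open TensorProduct

/-- The maximum `X`-rank in `⟨X⟩` for the flag variety `X = F(0,1;2)` is at most `3`:
every element of the linear span of the cone `D = {v∧w⊗v}` is a sum of three elements
of `D`. -/
theorem flag_variety_max_rank_three
    (ι : (Fin 3 → ℂ) →ₗ[ℂ] ExteriorAlgebra ℂ (Fin 3 → ℂ))
    (hι : ι = ExteriorAlgebra.ι ℂ)
    (D : Set (ExteriorAlgebra ℂ (Fin 3 → ℂ) ⊗[ℂ] (Fin 3 → ℂ)))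
    (hD : D = {x | ∃ v w : Fin 3 → ℂ, x = (ι v * ι w) ⊗ₜ[ℂ] v}) :
    ∀ x ∈ Submodule.span ℂ D,
      ∃ v₁ w₁ v₂ w₂ v₃ w₃ : Fin 3 → ℂ,
        x = (ι v₁ * ι w₁) ⊗ₜ[ℂ] v₁ + (ι v₂ * ι w₂) ⊗ₜ[ℂ] v₂ +
            (ι v₃ * ι w₃) ⊗ₜ[ℂ] v₃ := by
  subst hι hD
  intro x hx
  let ω : Module.Dual ℂ (Fin 3 → ℂ) →ₗ[ℂ] ExteriorAlgebra ℂ (Fin 3 → ℂ) :=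
    bivector ℂ ∘ₗ (dotProductEquiv ℂ (Fin 3)).symm.toLinearMap
  have hspan : Submodule.span ℂ {x | ∃ v w : Fin 3 → ℂ,
        x = (ExteriorAlgebra.ι ℂ v * ExteriorAlgebra.ι ℂ w) ⊗ₜ[ℂ] v} ≤
      (contractLeft ℂ (Fin 3 → ℂ)).ker.map (ω.rTensor (Fin 3 → ℂ)) := by
    rw [Submodule.span_le]
    rintro _ ⟨v, w, rfl⟩
    refine ⟨dotProductEquiv ℂ (Fin 3) (crossProduct v w) ⊗ₜ v, ?_, ?_⟩
    · change dotProductEquiv ℂ (Fin 3) (crossProduct v w) v = 0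
      rw [dotProductEquiv_apply_apply, dotProduct_comm, dot_self_cross]
    · simp [ω, bivector_crossProduct]
  obtain ⟨t, ht, rfl⟩ := hspan hx
  obtain ⟨b, hb⟩ := LinearMap.exists_basis_coord_apply_eq_zero_of_trace_eq_zero 3
    (Module.finrank_fin_fun ℂ) (dualTensorHom ℂ (Fin 3 → ℂ) (Fin 3 → ℂ) t)
    (by rw [LinearMap.trace_eq_contract_apply]; exact ht)
  have htsum : t = ∑ i, (b.coord i ∘ₗ dualTensorHom ℂ (Fin 3 → ℂ) (Fin 3 → ℂ) t) ⊗ₜ b i := by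
    apply (dualTensorHomEquiv ℂ (Fin 3 → ℂ) (Fin 3 → ℂ)).injective
    refine LinearMap.ext fun u => ?_
    simp [dualTensorHom_apply, b.sum_repr]
  have hω (i : Fin 3) : ∃ w, ω (b.coord i ∘ₗ dualTensorHom ℂ (Fin 3 → ℂ) (Fin 3 → ℂ) t) =
      ExteriorAlgebra.ι ℂ (b i) * ExteriorAlgebra.ι ℂ w := by
    obtain ⟨p, hp⟩ := (dotProductEquiv ℂ (Fin 3)).surjective
      (b.coord i ∘ₗ dualTensorHom ℂ (Fin 3 → ℂ) (Fin 3 → ℂ) t)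
    obtain ⟨w, rfl⟩ := exists_crossProduct_eq (b.ne_zero i)
      (show p ⬝ᵥ b i = 0 by rw [← dotProductEquiv_apply_apply, hp]; exact hb i)
    exact ⟨w, by simp [ω, ← hp, bivector_crossProduct]⟩
  choose w hw using hω
  refine ⟨b 0, w 0, b 1, w 1, b 2, w 2, ?_⟩
  conv_lhs => rw [htsum]
  simp only [Fin.sum_univ_three, map_add, LinearMap.rTensor_tmul, hw]
end

section
/- Every traceless 3×3 complex matrix is a sum of three traceless matrices of rank at most 1: for every M : Matrix (Fin 3) (Fin 3) ℂ with trace M = 0 there exist vectors v₁, v₂, v₃, w₁, w₂, w₃ : Fin 3 → ℂ with wᵢ ⬝ᵥ vᵢ = 0 for i = 1, 2, 3 and M = vecMulVec v₁ w₁ + vecMulVec v₂ w₂ + vecMulVec v₃ w₃. -/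
open Matrix

/-- A non-scalar `2×2` matrix `(a, b; c, d)` has a conjugate by a matrix `(p, q; r, s)` of
determinant one whose upper left entry vanishes. -/
theorem exists_conj_upper_left_eq_zero {K : Type*} [Field K] {a b c d : K}
    (h : ¬(b = 0 ∧ c = 0 ∧ a = d)) :
    ∃ p q r s : K, p * s - q * r = 1 ∧ (p * a + q * c) * s - (p * b + q * d) * r = 0 := by
  by_cases hc : c = 0
  · by_cases hb : b = 0
    · have had : a - d ≠ 0 := fun e => h ⟨hb, hc, sub_eq_zero.mp e⟩
      refine ⟨1, 1, -a / (a - d), -d / (a - d), ?_, ?_⟩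
      · field_simp
        ring
      · subst hb hc
        field_simp
        ring
    · refine ⟨1, 0, a / b, 1, by ring, ?_⟩
      field_simp
      ring
  · refine ⟨1, -a / c, 0, 1, by ring, ?_⟩
    field_simp
    ring

/-- A traceless `3×3` matrix has a conjugate whose first diagonal entry vanishes. -/
theorem exists_conj_apply_zero_zero_eq_zero {K : Type*} [Field K] [CharZero K]
    (M : Matrix (Fin 3) (Fin 3) K) (hM : M.trace = 0) :
    ∃ P Q : Matrix (Fin 3) (Fin 3) K, Q * P = 1 ∧ (P * M * Q) 0 0 = 0 := by
  by_cases h₁ : M 0 1 = 0 ∧ M 1 0 = 0 ∧ M 0 0 = M 1 1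
  · by_cases h₂ : M 0 2 = 0 ∧ M 2 0 = 0 ∧ M 0 0 = M 2 2
    · refine ⟨1, 1, one_mul 1, ?_⟩
      rw [trace_fin_three, ← h₁.2.2, ← h₂.2.2] at hM
      have h : (3 : K) * M 0 0 = 0 := by linear_combination hM
      simpa using h
    · obtain ⟨p, q, r, s, hdet, h⟩ := exists_conj_upper_left_eq_zero h₂
      refine ⟨!![p, 0, q; 0, 1, 0; r, 0, s], !![s, 0, -q; 0, 1, 0; -r, 0, p], ?_, ?_⟩
      · ext i j
        fin_cases i <;> fin_cases j <;> simp [Matrix.mul_apply, Fin.sum_univ_three] <;>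
          first | ring1 | linear_combination hdet
      · simp only [Matrix.mul_apply, Fin.sum_univ_three]
        simp
        linear_combination h
  · obtain ⟨p, q, r, s, hdet, h⟩ := exists_conj_upper_left_eq_zero h₁
    refine ⟨!![p, q, 0; r, s, 0; 0, 0, 1], !![s, -q, 0; -r, p, 0; 0, 0, 1], ?_, ?_⟩
    · ext i j
      fin_cases i <;> fin_cases j <;> simp [Matrix.mul_apply, Fin.sum_univ_three] <;>
        first | ring1 | linear_combination hdet
    · simp only [Matrix.mul_apply, Fin.sum_univ_three]
      simp
      linear_combination h

/-- A traceless `3×3` matrix is conjugate to a matrix with zero diagonal. -/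
theorem exists_conj_diag_eq_zero {K : Type*} [Field K] [CharZero K]
    (M : Matrix (Fin 3) (Fin 3) K) (hM : M.trace = 0) :
    ∃ P Q : Matrix (Fin 3) (Fin 3) K, Q * P = 1 ∧ ∀ i, (P * M * Q) i i = 0 := by
  obtain ⟨P, Q, hQP, h₀⟩ := exists_conj_apply_zero_zero_eq_zero M hM
  have hN : (P * M * Q).trace = 0 := by
    rw [trace_mul_comm, ← Matrix.mul_assoc, hQP, Matrix.one_mul, hM]
  generalize hN' : P * M * Q = N at h₀ hN
  rw [trace_fin_three, h₀, zero_add] at hN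
  by_cases h : N 1 2 = 0 ∧ N 2 1 = 0 ∧ N 1 1 = N 2 2
  · have h₂ : N 2 2 = 0 := by
      rw [h.2.2] at hN
      simpa using hN
    refine ⟨P, Q, hQP, fun i => ?_⟩
    rw [hN']
    fin_cases i
    exacts [h₀, h.2.2.trans h₂, h₂]
  · obtain ⟨p, q, r, s, hdet, h⟩ := exists_conj_upper_left_eq_zero h
    refine ⟨!![1, 0, 0; 0, p, q; 0, r, s] * P, Q * !![1, 0, 0; 0, s, -q; 0, -r, p], ?_, ?_⟩
    · have hinv : !![1, 0, 0; 0, s, -q; 0, -r, p] * !![1, 0, 0; 0, p, q; 0, r, s] = 1 := by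
        ext i j
        fin_cases i <;> fin_cases j <;> simp [Matrix.mul_apply, Fin.sum_univ_three] <;>
          first | ring1 | linear_combination hdet
      rw [Matrix.mul_assoc, ← Matrix.mul_assoc _ _ P, hinv, Matrix.one_mul, hQP]
    · intro i
      rw [show !![1, 0, 0; 0, p, q; 0, r, s] * P * M * (Q * !![1, 0, 0; 0, s, -q; 0, -r, p]) =
        !![1, 0, 0; 0, p, q; 0, r, s] * N * !![1, 0, 0; 0, s, -q; 0, -r, p] by
          simp only [← hN', Matrix.mul_assoc]]
      simp only [Matrix.mul_apply, Fin.sum_univ_three]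
      fin_cases i <;> simp
      · exact h₀
      · linear_combination h
      · linear_combination (p * s - q * r) * hN - h

/-- Every traceless `3×3` complex matrix is a sum of three traceless matrices of rank
at most one. -/
theorem traceless_sum_three_rank_one (M : Matrix (Fin 3) (Fin 3) ℂ)
    (hM : Matrix.trace M = 0) :
    ∃ v₁ v₂ v₃ w₁ w₂ w₃ : Fin 3 → ℂ,
      w₁ ⬝ᵥ v₁ = 0 ∧ w₂ ⬝ᵥ v₂ = 0 ∧ w₃ ⬝ᵥ v₃ = 0 ∧
      M = Matrix.vecMulVec v₁ w₁ + Matrix.vecMulVec v₂ w₂ + Matrix.vecMulVec v₃ w₃ := by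
  obtain ⟨P, Q, hQP, h⟩ := exists_conj_diag_eq_zero M hM
  refine ⟨Q.col 0, Q.col 1, Q.col 2, (P * M).row 0, (P * M).row 1, (P * M).row 2,
    h 0, h 1, h 2, ?_⟩
  calc M = Q * (P * M) := by rw [← Matrix.mul_assoc, hQP, Matrix.one_mul]
    _ = _ := by
      ext i j
      simp [Matrix.mul_apply (M := Q), Fin.sum_univ_three, vecMulVec_apply]
end

section
/- Every homogeneous polynomial of degree 3 in three variables over ℂ is a sum of at most 6 cubes of linear forms: for every f ∈ MvPolynomial (Fin 3) ℂ with IsHomogeneous f 3 there exist l₁, …, l₆ ∈ MvPolynomial (Fin 3) ℂ, each homogeneous of degree 1, such that f = l₁³ + l₂³ + l₃³ + l₄³ + l₅³ + l₆³. -/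
open MvPolynomial

/-- The function `f` is a sum of six cubes of linear functionals. -/
def IsSumOfSixCubes {V : Type*} [AddCommGroup V] [Module ℂ V] (f : V → ℂ) : Prop :=
  ∃ l : Fin 6 → Module.Dual ℂ V, ∀ w, f w = ∑ i, l i w ^ 3

theorem exists_cube_eq (a : ℂ) : ∃ r : ℂ, r ^ 3 = a :=
  IsAlgClosed.exists_pow_nat_eq a (by norm_num)

/-- The binary cubic `α u ^ 3 + 3 u ^ 2 x` is a sum of two cubes up to a multiple of `x ^ 3`. -/
theorem exists_two_cubes_modulo_cube (α : ℂ) : ∃ p q p' q' : ℂ,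
    p ^ 3 + p' ^ 3 = α ∧ p ^ 2 * q + p' ^ 2 * q' = 1 ∧ p * q ^ 2 + p' * q' ^ 2 = 0 := by
  by_cases hα : α = 0
  · exact ⟨1, 1 / 2, -1, 1 / 2, by rw [hα]; norm_num, by norm_num, by norm_num⟩
  · obtain ⟨r, hr⟩ := exists_cube_eq (-α / 63)
    have hr0 : r ≠ 0 := by
      rintro rfl
      exact hα (by linear_combination 63 * hr)
    refine ⟨-4 * r, 1 / (14 * r ^ 2), r, -2 / (14 * r ^ 2), ?_, ?_, ?_⟩
    · linear_combination -63 * hr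
    · field_simp
      norm_num
    · field_simp
      norm_num

/-- The two mixed coefficients of a binary cubic can be matched by those of a single cube when
both or neither of them vanish. -/
theorem exists_cube_with_mixed_coeffs {c₁ c₂ : ℂ} (h : c₁ = 0 ↔ c₂ = 0) :
    ∃ s t : ℂ, s ^ 2 * t = c₁ ∧ s * t ^ 2 = c₂ := by
  by_cases h₁ : c₁ = 0
  · exact ⟨0, 0, by simp [h₁], by simp [h.1 h₁]⟩
  · have h₂ : c₂ ≠ 0 := fun h₂ => h₁ (h.2 h₂)
    obtain ⟨s, hs⟩ := exists_cube_eq (c₁ ^ 2 / c₂)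
    have hs' : s ^ 3 * c₂ = c₁ ^ 2 := by rw [hs]; field_simp
    refine ⟨s, c₂ * s / c₁, ?_, ?_⟩
    · field_simp
      linear_combination hs'
    · field_simp
      linear_combination hs'

section

variable {V : Type*} [AddCommGroup V] [Module ℂ V]

theorem binaryCubic_sum_three_cubes_of_right_eq_zero (u v : Module.Dual ℂ V) (c₀ c₁ c₃ : ℂ) :
    ∃ m₁ m₂ m₃ : Module.Dual ℂ V, ∀ w,
      c₀ * u w ^ 3 + 3 * c₁ * u w ^ 2 * v w + c₃ * v w ^ 3
        = m₁ w ^ 3 + m₂ w ^ 3 + m₃ w ^ 3 := by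
  obtain ⟨p, q, p', q', h₁, h₂, h₃⟩ := exists_two_cubes_modulo_cube c₀
  obtain ⟨r, hr⟩ := exists_cube_eq (c₃ - (q ^ 3 + q' ^ 3) * c₁ ^ 3)
  refine ⟨p • u + (q * c₁) • v, p' • u + (q' * c₁) • v, r • v, fun w => ?_⟩
  simp only [LinearMap.add_apply, LinearMap.smul_apply, smul_eq_mul]
  linear_combination -u w ^ 3 * h₁ - 3 * c₁ * u w ^ 2 * v w * h₂
    - 3 * c₁ ^ 2 * u w * v w ^ 2 * h₃ - v w ^ 3 * hr

theorem binaryCubic_sum_three_cubes (u v : Module.Dual ℂ V) (c₀ c₁ c₂ c₃ : ℂ) :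
    ∃ m₁ m₂ m₃ : Module.Dual ℂ V, ∀ w,
      c₀ * u w ^ 3 + 3 * c₁ * u w ^ 2 * v w + 3 * c₂ * u w * v w ^ 2 + c₃ * v w ^ 3
        = m₁ w ^ 3 + m₂ w ^ 3 + m₃ w ^ 3 := by
  by_cases h₂ : c₂ = 0
  · obtain ⟨m₁, m₂, m₃, h⟩ := binaryCubic_sum_three_cubes_of_right_eq_zero u v c₀ c₁ c₃
    exact ⟨m₁, m₂, m₃, fun w => by rw [← h w, h₂]; ring⟩
  by_cases h₁ : c₁ = 0
  · obtain ⟨m₁, m₂, m₃, h⟩ := binaryCubic_sum_three_cubes_of_right_eq_zero v u c₃ c₂ c₀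
    exact ⟨m₁, m₂, m₃, fun w => by rw [← h w, h₁]; ring⟩
  obtain ⟨s, t, hs, ht⟩ := exists_cube_with_mixed_coeffs (iff_of_false h₁ h₂)
  obtain ⟨α, hα⟩ := exists_cube_eq (c₀ - s ^ 3)
  obtain ⟨β, hβ⟩ := exists_cube_eq (c₃ - t ^ 3)
  refine ⟨s • u + t • v, α • u, β • v, fun w => ?_⟩
  simp only [LinearMap.add_apply, LinearMap.smul_apply, smul_eq_mul]
  linear_combination -u w ^ 3 * hα - v w ^ 3 * hβ - 3 * u w ^ 2 * v w * hs
    - 3 * u w * v w ^ 2 * ht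

/-- The cubic `a x ^ 3 + 3 x (e₁ u ^ 2 + e₂ v ^ 2) + C(u, v)`, where `C` is the binary cubic
with normalized coefficients `c₀, c₁, c₂, c₃`. -/
def diagonalCubic (x u v : Module.Dual ℂ V) (a e₁ e₂ c₀ c₁ c₂ c₃ : ℂ) (w : V) : ℂ :=
  a * x w ^ 3 + 3 * x w * (e₁ * u w ^ 2 + e₂ * v w ^ 2)
    + (c₀ * u w ^ 3 + 3 * c₁ * u w ^ 2 * v w + 3 * c₂ * u w * v w ^ 2 + c₃ * v w ^ 3)

theorem diagonalCubic_swap (x u v : Module.Dual ℂ V) (a e₁ e₂ c₀ c₁ c₂ c₃ : ℂ) :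
    diagonalCubic x u v a e₁ e₂ c₀ c₁ c₂ c₃ = diagonalCubic x v u a e₂ e₁ c₃ c₂ c₁ c₀ := by
  funext w
  unfold diagonalCubic
  ring

theorem isSumOfSixCubes_diagonalCubic_of_iff (x u v : Module.Dual ℂ V)
    (a e₁ e₂ c₀ c₁ c₂ c₃ : ℂ) (h : c₁ = 0 ↔ c₂ = 0) :
    IsSumOfSixCubes (diagonalCubic x u v a e₁ e₂ c₀ c₁ c₂ c₃) := by
  obtain ⟨s, t, hs, ht⟩ := exists_cube_with_mixed_coeffs h
  obtain ⟨p, q, p', q', h₁, h₂, h₃⟩ := exists_two_cubes_modulo_cube (c₀ - s ^ 3)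
  obtain ⟨m, n, m', n', k₁, k₂, k₃⟩ := exists_two_cubes_modulo_cube (c₃ - t ^ 3)
  obtain ⟨r, hr⟩ :=
    exists_cube_eq (a - (q ^ 3 + q' ^ 3) * e₁ ^ 3 - (n ^ 3 + n' ^ 3) * e₂ ^ 3)
  refine ⟨![s • u + t • v, p • u + (q * e₁) • x, p' • u + (q' * e₁) • x,
    m • v + (n * e₂) • x, m' • v + (n' * e₂) • x, r • x], fun w => ?_⟩
  simp only [diagonalCubic, Fin.sum_univ_six, Matrix.cons_val, LinearMap.add_apply,
    LinearMap.smul_apply, smul_eq_mul]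
  linear_combination -u w ^ 3 * h₁ - 3 * e₁ * u w ^ 2 * x w * h₂
    - 3 * e₁ ^ 2 * u w * x w ^ 2 * h₃ - v w ^ 3 * k₁ - 3 * e₂ * v w ^ 2 * x w * k₂
    - 3 * e₂ ^ 2 * v w * x w ^ 2 * k₃ - x w ^ 3 * hr - 3 * u w ^ 2 * v w * hs
    - 3 * u w * v w ^ 2 * ht

theorem isSumOfSixCubes_diagonalCubic_of_degenerate (x u v : Module.Dual ℂ V)
    (a e₁ c₀ c₁ c₂ c₃ : ℂ) :
    IsSumOfSixCubes (diagonalCubic x u v a e₁ 0 c₀ c₁ c₂ c₃) := by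
  obtain ⟨m₁, m₂, m₃, hm⟩ := binaryCubic_sum_three_cubes u v c₀ c₁ c₂ c₃
  obtain ⟨n₁, n₂, n₃, hn⟩ := binaryCubic_sum_three_cubes_of_right_eq_zero u x 0 e₁ a
  refine ⟨![m₁, m₂, m₃, n₁, n₂, n₃], fun w => ?_⟩
  simp only [diagonalCubic, Fin.sum_univ_six, Matrix.cons_val]
  linear_combination hm w + hn w

/-- A rotation parameter making both mixed coefficients of the binary part nonzero. -/
theorem exists_rotation_parameter {e₁ e₂ c₁ : ℂ} (c₀ c₃ : ℂ) (h₁ : e₁ ≠ 0) (h₂ : e₂ ≠ 0)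
    (hc : c₁ ≠ 0) : ∃ t : ℂ, 1 + e₁ * e₂ * t ^ 2 ≠ 0 ∧
      -c₀ * e₂ * t + c₁ * (1 - 2 * e₁ * e₂ * t ^ 2) + c₃ * e₁ ^ 2 * t ^ 2 ≠ 0 ∧
      c₀ * e₂ ^ 2 * t ^ 2 + c₁ * (e₁ * e₂ ^ 2 * t ^ 3 - 2 * e₂ * t) + c₃ * e₁ * t ≠ 0 := by
  let X : Polynomial ℂ := Polynomial.X
  let K : ℂ → Polynomial ℂ := Polynomial.C
  let P : Polynomial ℂ := 1 + K (e₁ * e₂) * X ^ 2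
  let Q : Polynomial ℂ := K c₁ + K (-c₀ * e₂) * X + K (c₃ * e₁ ^ 2 - 2 * c₁ * e₁ * e₂) * X ^ 2
  let R : Polynomial ℂ := K (c₃ * e₁ - 2 * c₁ * e₂) * X + K (c₀ * e₂ ^ 2) * X ^ 2
    + K (c₁ * e₁ * e₂ ^ 2) * X ^ 3
  have hP : P ≠ 0 := fun h => by
    simpa [P, K, X] using congrArg (Polynomial.eval 0) h
  have hQ : Q ≠ 0 := fun h => hc (by
    simpa [Q, K, X] using congrArg (Polynomial.eval 0) h)
  have hR : R ≠ 0 := fun h => by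
    have h3 := congrArg (fun p => Polynomial.coeff p 3) h
    simp [R, K, X, Polynomial.coeff_X_pow, -map_mul, -map_sub, -map_pow,
      h₁, h₂, hc] at h3
  have hne : P * Q * R ≠ 0 := mul_ne_zero (mul_ne_zero hP hQ) hR
  obtain ⟨t, ht⟩ : ∃ t, (P * Q * R).eval t ≠ 0 := by
    by_contra! hall
    exact hne (Polynomial.funext fun t => by simpa using hall t)
  rw [Polynomial.eval_mul, Polynomial.eval_mul] at ht
  refine ⟨t, fun h => ht ?_, fun h => ht ?_, fun h => ht ?_⟩
  · have : P.eval t = 0 := by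
      simp [P, K, X]
      linear_combination h
    simp [this]
  · have : Q.eval t = 0 := by
      simp [Q, K, X]
      linear_combination h
    simp [this]
  · have : R.eval t = 0 := by
      simp [R, K, X]
      linear_combination h
    simp [this]

theorem isSumOfSixCubes_diagonalCubic_of_left_ne_zero (x u v : Module.Dual ℂ V)
    (a e₁ e₂ c₀ c₁ c₃ : ℂ) (hc : c₁ ≠ 0) :
    IsSumOfSixCubes (diagonalCubic x u v a e₁ e₂ c₀ c₁ 0 c₃) := by
  by_cases h₂ : e₂ = 0
  · rw [h₂]
    exact isSumOfSixCubes_diagonalCubic_of_degenerate ..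
  by_cases h₁ : e₁ = 0
  · rw [h₁, diagonalCubic_swap]
    exact isSumOfSixCubes_diagonalCubic_of_degenerate ..
  obtain ⟨t, hd, hl, hr⟩ := exists_rotation_parameter c₀ c₃ h₁ h₂ hc
  set d := 1 + e₁ * e₂ * t ^ 2 with hd_def
  let u' : Module.Dual ℂ V := d⁻¹ • (u + (e₂ * t) • v)
  let v' : Module.Dual ℂ V := d⁻¹ • (v - (e₁ * t) • u)
  have key := isSumOfSixCubes_diagonalCubic_of_iff x u' v' a
    (e₁ + e₂ * (e₁ * t) ^ 2) (e₁ * (e₂ * t) ^ 2 + e₂)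
    (c₀ + 3 * c₁ * (e₁ * t) + c₃ * (e₁ * t) ^ 3) _ _
    (-c₀ * (e₂ * t) ^ 3 + 3 * c₁ * (e₂ * t) ^ 2 + c₃) (iff_of_false hl hr)
  convert key using 1
  funext w
  have hu : u w = u' w - e₂ * t * v' w := by
    simp only [u', v', LinearMap.add_apply, LinearMap.sub_apply, LinearMap.smul_apply,
      smul_eq_mul]
    field_simp
    rw [hd_def]
    ring
  have hv : v w = e₁ * t * u' w + v' w := by
    simp only [u', v', LinearMap.add_apply, LinearMap.sub_apply, LinearMap.smul_apply,
      smul_eq_mul]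
    field_simp
    rw [hd_def]
    ring
  simp only [diagonalCubic, hu, hv]
  ring

theorem isSumOfSixCubes_diagonalCubic (x u v : Module.Dual ℂ V) (a e₁ e₂ c₀ c₁ c₂ c₃ : ℂ) :
    IsSumOfSixCubes (diagonalCubic x u v a e₁ e₂ c₀ c₁ c₂ c₃) := by
  by_cases h₁ : c₁ = 0 <;> by_cases h₂ : c₂ = 0
  · exact isSumOfSixCubes_diagonalCubic_of_iff _ _ _ _ _ _ _ _ _ _ (iff_of_true h₁ h₂)
  · rw [h₁, diagonalCubic_swap]
    exact isSumOfSixCubes_diagonalCubic_of_left_ne_zero _ _ _ _ _ _ _ _ _ h₂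
  · rw [h₂]
    exact isSumOfSixCubes_diagonalCubic_of_left_ne_zero _ _ _ _ _ _ _ _ _ h₁
  · exact isSumOfSixCubes_diagonalCubic_of_iff _ _ _ _ _ _ _ _ _ _ (iff_of_false h₁ h₂)

/-- The cubic `a x ^ 3 + 3 x ^ 2 (b₁ y + b₂ z) + 3 x Q(y, z) + C(y, z)` with normalized
coefficients `q₀, q₁, q₂` of `Q` and `c₀, c₁, c₂, c₃` of `C`. -/
def ternaryCubic (x y z : Module.Dual ℂ V) (a b₁ b₂ q₀ q₁ q₂ c₀ c₁ c₂ c₃ : ℂ) (w : V) : ℂ :=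
  a * x w ^ 3 + 3 * x w ^ 2 * (b₁ * y w + b₂ * z w)
    + 3 * x w * (q₀ * y w ^ 2 + 2 * q₁ * y w * z w + q₂ * z w ^ 2)
    + (c₀ * y w ^ 3 + 3 * c₁ * y w ^ 2 * z w + 3 * c₂ * y w * z w ^ 2 + c₃ * z w ^ 3)

theorem isSumOfSixCubes_depressed_of_ne_zero (x y z : Module.Dual ℂ V)
    (a q₀ q₁ q₂ c₀ c₁ c₂ c₃ : ℂ) (h : q₀ ≠ 0) :
    IsSumOfSixCubes (ternaryCubic x y z a 0 0 q₀ q₁ q₂ c₀ c₁ c₂ c₃) := by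
  obtain ⟨m, rfl⟩ : ∃ m, q₁ = m * q₀ := ⟨q₁ / q₀, by field_simp⟩
  convert isSumOfSixCubes_diagonalCubic x (y + m • z) z a q₀ (q₂ - m ^ 2 * q₀)
    c₀ (c₁ - c₀ * m) (c₂ - 2 * c₁ * m + c₀ * m ^ 2)
    (c₃ - 3 * c₂ * m + 3 * c₁ * m ^ 2 - c₀ * m ^ 3) using 1
  funext w
  simp only [ternaryCubic, diagonalCubic, LinearMap.add_apply, LinearMap.smul_apply, smul_eq_mul]
  ring

theorem isSumOfSixCubes_depressed (x y z : Module.Dual ℂ V) (a q₀ q₁ q₂ c₀ c₁ c₂ c₃ : ℂ) :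
    IsSumOfSixCubes (ternaryCubic x y z a 0 0 q₀ q₁ q₂ c₀ c₁ c₂ c₃) := by
  by_cases h₀ : q₀ = 0
  · by_cases h₂ : q₂ = 0
    · convert isSumOfSixCubes_diagonalCubic x ((1 / 2 : ℂ) • (y + z)) ((1 / 2 : ℂ) • (y - z)) a
        (2 * q₁) (-2 * q₁) (c₀ + 3 * c₁ + 3 * c₂ + c₃) (c₀ + c₁ - c₂ - c₃) (c₀ - c₁ - c₂ + c₃)
        (c₀ - 3 * c₁ + 3 * c₂ - c₃) using 1
      funext w
      simp only [ternaryCubic, diagonalCubic, h₀, h₂, LinearMap.add_apply, LinearMap.sub_apply,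
        LinearMap.smul_apply, smul_eq_mul]
      ring
    · convert isSumOfSixCubes_depressed_of_ne_zero x z y a q₂ q₁ q₀ c₃ c₂ c₁ c₀ h₂ using 1
      funext w
      unfold ternaryCubic
      ring
  · exact isSumOfSixCubes_depressed_of_ne_zero x y z a q₀ q₁ q₂ c₀ c₁ c₂ c₃ h₀

theorem isSumOfSixCubes_ternaryCubic_of_ne_zero (x y z : Module.Dual ℂ V)
    (a b₁ b₂ q₀ q₁ q₂ c₀ c₁ c₂ c₃ : ℂ) (h : a ≠ 0) :
    IsSumOfSixCubes (ternaryCubic x y z a b₁ b₂ q₀ q₁ q₂ c₀ c₁ c₂ c₃) := by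
  obtain ⟨m, rfl⟩ : ∃ m, b₁ = m * a := ⟨b₁ / a, by field_simp⟩
  obtain ⟨n, rfl⟩ : ∃ n, b₂ = n * a := ⟨b₂ / a, by field_simp⟩
  convert isSumOfSixCubes_depressed (x + m • y + n • z) y z a
    (q₀ - a * m ^ 2) (q₁ - a * m * n) (q₂ - a * n ^ 2)
    (c₀ - 3 * m * q₀ + 2 * a * m ^ 3)
    (c₁ - n * q₀ - 2 * m * q₁ + 2 * a * m ^ 2 * n)
    (c₂ - m * q₂ - 2 * n * q₁ + 2 * a * m * n ^ 2)
    (c₃ - 3 * n * q₂ + 2 * a * n ^ 3) using 1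
  funext w
  simp only [ternaryCubic, LinearMap.add_apply, LinearMap.smul_apply, smul_eq_mul]
  ring

theorem isSumOfSixCubes_ternaryCubic (x y z : Module.Dual ℂ V)
    (a b₁ b₂ q₀ q₁ q₂ c₀ c₁ c₂ c₃ : ℂ) :
    IsSumOfSixCubes (ternaryCubic x y z a b₁ b₂ q₀ q₁ q₂ c₀ c₁ c₂ c₃) := by
  let F : ℂ → ℂ → ℂ := fun s t => a + 3 * (b₁ * s + b₂ * t)
    + 3 * (q₀ * s ^ 2 + 2 * q₁ * s * t + q₂ * t ^ 2)
    + (c₀ * s ^ 3 + 3 * c₁ * s ^ 2 * t + 3 * c₂ * s * t ^ 2 + c₃ * t ^ 3)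
  by_cases hF : ∀ s t, F s t = 0
  · have e1 := hF 0 0
    have e2 := hF 1 0
    have e3 := hF (-1) 0
    have e4 := hF 2 0
    have e5 := hF 0 1
    have e6 := hF 0 (-1)
    have e7 := hF 0 2
    have e8 := hF 1 1
    have e9 := hF 1 (-1)
    have e10 := hF (-1) 1
    simp only [F] at e1 e2 e3 e4 e5 e6 e7 e8 e9 e10
    refine ⟨0, fun w => ?_⟩
    have ha : a = 0 := by grind
    have hq₀ : q₀ = 0 := by grind
    have hq₂ : q₂ = 0 := by grind
    have hc₀ : c₀ = 0 := by grind
    have hc₃ : c₃ = 0 := by grind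
    have hb₁ : b₁ = 0 := by grind
    have hb₂ : b₂ = 0 := by grind
    have hq₁ : q₁ = 0 := by grind
    have hc₁ : c₁ = 0 := by grind
    have hc₂ : c₂ = 0 := by grind
    simp [ternaryCubic, ha, hb₁, hb₂, hq₀, hq₁, hq₂, hc₀, hc₁, hc₂, hc₃]
  · push Not at hF
    obtain ⟨s, t, hst⟩ := hF
    convert isSumOfSixCubes_ternaryCubic_of_ne_zero x (y - s • x) (z - t • x) (F s t)
      (b₁ + 2 * (q₀ * s + q₁ * t) + c₀ * s ^ 2 + 2 * c₁ * s * t + c₂ * t ^ 2)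
      (b₂ + 2 * (q₁ * s + q₂ * t) + c₁ * s ^ 2 + 2 * c₂ * s * t + c₃ * t ^ 2)
      (q₀ + c₀ * s + c₁ * t) (q₁ + c₁ * s + c₂ * t) (q₂ + c₂ * s + c₃ * t) c₀ c₁ c₂ c₃ hst using 1
    funext w
    simp only [F, ternaryCubic, LinearMap.sub_apply, LinearMap.smul_apply, smul_eq_mul]
    ring

end

theorem exists_eval_eq_ternaryCubic {f : MvPolynomial (Fin 3) ℂ} (hf : f.IsHomogeneous 3) :
    ∃ a b₁ b₂ q₀ q₁ q₂ c₀ c₁ c₂ c₃ : ℂ, (fun w => eval w f) =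
      ternaryCubic (LinearMap.proj (R := ℂ) (φ := fun _ : Fin 3 => ℂ) 0) (LinearMap.proj 1)
        (LinearMap.proj 2) a b₁ b₂ q₀ q₁ q₂ c₀ c₁ c₂ c₃ := by
  rw [f.as_sum]
  refine Finset.sum_induction _ (fun g => ∃ a b₁ b₂ q₀ q₁ q₂ c₀ c₁ c₂ c₃ : ℂ,
    (fun w => eval w g) = ternaryCubic (LinearMap.proj (R := ℂ) (φ := fun _ : Fin 3 => ℂ) 0)
      (LinearMap.proj 1) (LinearMap.proj 2) a b₁ b₂ q₀ q₁ q₂ c₀ c₁ c₂ c₃) ?_ ?_ ?_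
  · rintro g g' ⟨a, b₁, b₂, q₀, q₁, q₂, c₀, c₁, c₂, c₃, h⟩
      ⟨a', b₁', b₂', q₀', q₁', q₂', c₀', c₁', c₂', c₃', h'⟩
    refine ⟨a + a', b₁ + b₁', b₂ + b₂', q₀ + q₀', q₁ + q₁', q₂ + q₂', c₀ + c₀', c₁ + c₁',
      c₂ + c₂', c₃ + c₃', ?_⟩
    funext w
    have hw := congrFun h w
    have hw' := congrFun h' w
    simp only [ternaryCubic, map_add] at hw hw' ⊢
    linear_combination hw + hw'
  · refine ⟨0, 0, 0, 0, 0, 0, 0, 0, 0, 0, ?_⟩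
    funext w
    simp [ternaryCubic]
  · intro d hd
    have hdeg : d 0 + d 1 + d 2 = 3 := by
      have := hf (mem_support_iff.1 hd)
      simpa [Finsupp.weight_apply, Finsupp.sum_fintype, Fin.sum_univ_three] using this
    generalize coeff d f = k
    have heval : ∀ w : Fin 3 → ℂ,
        eval w (monomial d k) = k * (w 0 ^ d 0 * w 1 ^ d 1 * w 2 ^ d 2) := fun w => by
      simp [eval_monomial, Finsupp.prod_fintype, Fin.prod_univ_three]
    simp only [heval]
    generalize d 0 = i, d 1 = j, d 2 = m at hdeg
    obtain rfl : m = 3 - i - j := by lia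
    refine ⟨if i = 3 then k else 0, if i = 2 ∧ j = 1 then k / 3 else 0,
      if i = 2 ∧ j = 0 then k / 3 else 0, if i = 1 ∧ j = 2 then k / 3 else 0,
      if i = 1 ∧ j = 1 then k / 6 else 0, if i = 1 ∧ j = 0 then k / 3 else 0,
      if i = 0 ∧ j = 3 then k else 0, if i = 0 ∧ j = 2 then k / 3 else 0,
      if i = 0 ∧ j = 1 then k / 3 else 0, if i = 0 ∧ j = 0 then k else 0, ?_⟩
    funext w
    have hi : i ≤ 3 := by lia
    have hj : j ≤ 3 - i := by lia
    interval_cases i <;> interval_cases j <;> simp [ternaryCubic] <;> ring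

/-- The linear form with the same values as a given linear functional. -/
noncomputable def linearForm (l : Module.Dual ℂ (Fin 3 → ℂ)) : MvPolynomial (Fin 3) ℂ :=
  ∑ i, C (l (Pi.single i 1)) * X i

theorem isHomogeneous_linearForm (l : Module.Dual ℂ (Fin 3 → ℂ)) :
    (linearForm l).IsHomogeneous 1 :=
  IsHomogeneous.sum _ _ _ fun i _ => isHomogeneous_C_mul_X _ i

theorem eval_linearForm (l : Module.Dual ℂ (Fin 3 → ℂ)) (w : Fin 3 → ℂ) :
    eval w (linearForm l) = l w := by
  rw [LinearMap.pi_apply_eq_sum_univ l w]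
  simp only [linearForm, map_sum, map_mul, eval_C, eval_X, smul_eq_mul]
  refine Finset.sum_congr rfl fun i _ => ?_
  rw [mul_comm]
  congr 2
  funext j
  simp [Pi.single_apply, eq_comm]

/-- Every ternary cubic form over `ℂ` is a sum of at most `6` cubes of linear forms. -/
theorem ternary_cubic_sum_six_cubes (f : MvPolynomial (Fin 3) ℂ)
    (hf : f.IsHomogeneous 3) :
    ∃ l₁ l₂ l₃ l₄ l₅ l₆ : MvPolynomial (Fin 3) ℂ,
      l₁.IsHomogeneous 1 ∧ l₂.IsHomogeneous 1 ∧ l₃.IsHomogeneous 1 ∧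
      l₄.IsHomogeneous 1 ∧ l₅.IsHomogeneous 1 ∧ l₆.IsHomogeneous 1 ∧
      f = l₁ ^ 3 + l₂ ^ 3 + l₃ ^ 3 + l₄ ^ 3 + l₅ ^ 3 + l₆ ^ 3 := by
  obtain ⟨a, b₁, b₂, q₀, q₁, q₂, c₀, c₁, c₂, c₃, h⟩ := exists_eval_eq_ternaryCubic hf
  obtain ⟨l, hl⟩ : IsSumOfSixCubes fun w => eval w f := by
    rw [h]
    exact isSumOfSixCubes_ternaryCubic ..
  refine ⟨linearForm (l 0), linearForm (l 1), linearForm (l 2), linearForm (l 3),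
    linearForm (l 4), linearForm (l 5), isHomogeneous_linearForm _, isHomogeneous_linearForm _,
    isHomogeneous_linearForm _, isHomogeneous_linearForm _, isHomogeneous_linearForm _,
    isHomogeneous_linearForm _, MvPolynomial.funext fun w => ?_⟩
  simp only [map_add, map_pow, eval_linearForm]
  exact (hl w).trans (Fin.sum_univ_six _)
end

section
/- Every homogeneous polynomial of degree 4 in three variables over ℂ is a sum of at most 8 fourth powers of linear forms: for every f ∈ MvPolynomial (Fin 3) ℂ with IsHomogeneous f 4 there exist l₁, …, l₈ ∈ MvPolynomial (Fin 3) ℂ, each homogeneous of degree 1, such that f = l₁⁴ + l₂⁴ + ⋯ + l₈⁴. -/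
open MvPolynomial

/-- A generic member of a base-point-free pencil of binary forms of degree `e` (dehomogenized)
has `e` distinct roots. -/
lemma exists_add_smul_nodup_roots {e : ℕ} (he : 1 ≤ e) {g h : Polynomial ℂ}
    (hg : g.natDegree ≤ e) (hh : h.natDegree ≤ e) (hgh : IsCoprime g h)
    (htop : g.coeff e ≠ 0 ∨ h.coeff e ≠ 0) :
    ∃ s : ℂ, (g + s • h).natDegree = e ∧ (g + s • h).roots.Nodup := by
  classical
  set W := g.derivative * h - g * h.derivative with hWdef
  have hconst : ∀ a b : Polynomial ℂ, IsCoprime a b →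
      a.derivative * b - a * b.derivative = 0 → a.derivative = 0 := by
    intro a b hab h0
    have hdvd : a ∣ a.derivative :=
      hab.dvd_of_dvd_mul_right ⟨b.derivative, by linear_combination h0⟩
    by_contra hne
    have hna : a ≠ 0 := by rintro rfl; simp at hne
    have := Polynomial.degree_le_of_dvd hdvd hne
    exact absurd (Polynomial.degree_derivative_lt hna) (not_lt.mpr this)
  have hcoeff : ∀ a : Polynomial ℂ, a.derivative = 0 → a.coeff e = 0 := by
    intro a ha
    obtain ⟨n, rfl⟩ : ∃ n, e = n + 1 := ⟨e - 1, by omega⟩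
    have := congrArg (fun p => p.coeff n) ha
    simp only [Polynomial.coeff_derivative, Polynomial.coeff_zero, mul_eq_zero] at this
    exact this.resolve_right (by exact_mod_cast Nat.succ_ne_zero n)
  have hW : W ≠ 0 := by
    intro h0
    have h1 := hcoeff g (hconst g h hgh h0)
    have h2 := hcoeff h (hconst h g hgh.symm (by rw [hWdef] at h0; linear_combination -h0))
    tauto
  let bad : Finset ℂ := W.roots.toFinset.image (fun t => - g.eval t / h.eval t) ∪
    {- g.coeff e / h.coeff e}
  obtain ⟨s, hs⟩ := Infinite.exists_notMem_finset bad
  simp only [bad, Finset.mem_union, Finset.mem_image, Multiset.mem_toFinset,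
    Finset.mem_singleton, not_or, not_exists, not_and] at hs
  have hdeg : (g + s • h).natDegree = e := by
    refine Polynomial.natDegree_eq_of_le_of_coeff_ne_zero ?_ ?_
    · exact (Polynomial.natDegree_add_le _ _).trans
        (max_le hg ((Polynomial.natDegree_smul_le _ _).trans hh))
    · simp only [Polynomial.coeff_add, Polynomial.coeff_smul, smul_eq_mul]
      intro h0
      by_cases hz : h.coeff e = 0
      · simp [hz] at h0; tauto
      · exact hs.2 (by field_simp; linear_combination h0)
  refine ⟨s, hdeg, ?_⟩
  have hne : g + s • h ≠ 0 := by intro h0; rw [h0] at hdeg; simp at hdeg; omega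
  rw [Multiset.nodup_iff_count_le_one]
  intro t
  rw [Polynomial.count_roots]
  by_contra hlt
  push Not at hlt
  obtain ⟨h1, h2⟩ := (Polynomial.one_lt_rootMultiplicity_iff_isRoot hne).1 hlt
  simp only [Polynomial.IsRoot.def, Polynomial.derivative_add, Polynomial.derivative_smul,
    Polynomial.eval_add, Polynomial.eval_smul, smul_eq_mul] at h1 h2
  have hht : h.eval t ≠ 0 := by
    intro h0
    obtain ⟨a, b, hab⟩ := hgh
    have := congrArg (Polynomial.eval t) hab
    rw [h0] at h1
    have hg0 : g.eval t = 0 := by simpa using h1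
    simp [hg0, h0] at this
  refine hs.1 t ?_ (by field_simp; linear_combination -h1)
  rw [Polynomial.mem_roots hW, Polynomial.IsRoot.def, hWdef]
  simp only [Polynomial.eval_sub, Polynomial.eval_mul]
  linear_combination h.eval t * h2 - h.derivative.eval t * h1

/-- Sylvester's quadrature: a functional annihilated by a base-point-free pencil of degree `e`
is a combination of `e` point evaluations. -/
lemma exists_quadrature_of_pencil {d e : ℕ} (he : 1 ≤ e) (Φ : Polynomial ℂ →ₗ[ℂ] ℂ)
    {g h : Polynomial ℂ} (hg : g.natDegree ≤ e) (hh : h.natDegree ≤ e) (hgh : IsCoprime g h)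
    (htop : g.coeff e ≠ 0 ∨ h.coeff e ≠ 0)
    (hΦg : ∀ j, e + j ≤ d → Φ (g * Polynomial.X ^ j) = 0)
    (hΦh : ∀ j, e + j ≤ d → Φ (h * Polynomial.X ^ j) = 0) :
    ∃ w t : Fin e → ℂ, ∀ n ≤ d, Φ (Polynomial.X ^ n) = ∑ i, w i * t i ^ n := by
  classical
  obtain ⟨s, hdeg, hnodup⟩ := exists_add_smul_nodup_roots he hg hh hgh htop
  set k := g + s • h with hk
  have hkX : ∀ j, e + j ≤ d → Φ (k * Polynomial.X ^ j) = 0 := by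
    intro j hj
    rw [hk, add_mul, smul_mul_assoc, map_add, map_smul, hΦg j hj, hΦh j hj]; simp
  have hk0 : k ≠ 0 := by intro h0; rw [h0] at hdeg; simp at hdeg; omega
  have hcard : k.roots.toFinset.card = e := by
    rw [Multiset.toFinset_card_of_nodup hnodup, ← hdeg]
    exact (IsAlgClosed.splits k).natDegree_eq_card_roots.symm
  let t : Fin e → ℂ := fun i => (k.roots.toFinset.equivFinOfCardEq hcard).symm i
  have ht : Function.Injective t := fun i j hij => by
    simpa [t] using hij
  have hroot : ∀ i, k.eval (t i) = 0 := by
    intro i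
    have := ((k.roots.toFinset.equivFinOfCardEq hcard).symm i).2
    rw [Multiset.mem_toFinset, Polynomial.mem_roots hk0] at this
    exact this
  refine ⟨fun i => Φ (Lagrange.basis Finset.univ t i), t, fun n hn => ?_⟩
  have hdegk : k.degree = e := by rw [Polynomial.degree_eq_natDegree hk0, hdeg]
  have hmod : (Polynomial.X ^ n % k : Polynomial ℂ).degree <
      ((Finset.univ : Finset (Fin e)).card : WithBot ℕ) := by
    have := Polynomial.degree_mod_lt (Polynomial.X ^ n) hk0
    rw [hdegk] at this
    simpa using this
  have hint := Lagrange.eq_interpolate (s := Finset.univ) (v := t) ht.injOn hmod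
  have hquot : Φ (k * (Polynomial.X ^ n / k)) = 0 := by
    set Q : Polynomial ℂ := Polynomial.X ^ n / k with hQ
    by_cases hne : n < e
    · have : Q = 0 := by
        rw [hQ, Polynomial.div_eq_zero_iff hk0, hdegk, Polynomial.degree_X_pow]
        exact_mod_cast hne
      simp [this]
    have hsum := Polynomial.degree_add_div (p := Polynomial.X ^ n) hk0
      (by rw [hdegk, Polynomial.degree_X_pow]; exact_mod_cast not_lt.1 hne)
    have hQ0 : Q ≠ 0 := by
      rw [hQ, Ne, Polynomial.div_eq_zero_iff hk0, hdegk, Polynomial.degree_X_pow]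
      exact_mod_cast hne
    rw [← hQ, hdegk, Polynomial.degree_X_pow, Polynomial.degree_eq_natDegree hQ0] at hsum
    have hsum' : e + Q.natDegree = n := by exact_mod_cast hsum
    rw [Q.as_sum_range_C_mul_X_pow, Finset.mul_sum, map_sum]
    refine Finset.sum_eq_zero fun j hj => ?_
    rw [Finset.mem_range] at hj
    rw [show k * (Polynomial.C (Q.coeff j) * Polynomial.X ^ j) =
      (Q.coeff j) • (k * Polynomial.X ^ j) by
        rw [Polynomial.smul_eq_C_mul]; ring, map_smul, hkX j (by omega), smul_zero]
  have heval : ∀ i, (Polynomial.X ^ n % k).eval (t i) = t i ^ n := by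
    intro i
    have := congrArg (Polynomial.eval (t i)) (EuclideanDomain.div_add_mod (Polynomial.X ^ n) k)
    simpa [hroot i] using this
  conv_lhs => rw [← EuclideanDomain.div_add_mod (Polynomial.X ^ n) k]
  rw [map_add, hquot, zero_add, hint, Lagrange.interpolate_apply, map_sum]
  refine Finset.sum_congr rfl fun i _ => ?_
  rw [← Polynomial.smul_eq_C_mul, map_smul, heval, smul_eq_mul, mul_comm]

/-- A binary form of degree `d` is a sum of `d` powers, none of them at infinity, unless it is
supported at infinity; stated for the sequence of moments of the dual functional. -/
lemma exists_moments_or_eq_zero {d : ℕ} (hd : 2 ≤ d) (c : ℕ → ℂ) :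
    (∃ w t : Fin d → ℂ, ∀ n ≤ d, c n = ∑ i, w i * t i ^ n) ∨ ∀ n < d, c n = 0 := by
  classical
  by_cases hall : ∀ n < d, c n = 0
  · exact Or.inr hall
  refine Or.inl ?_
  let Φ : Polynomial ℂ →ₗ[ℂ] ℂ := (Polynomial.basisMonomials ℂ).constr ℂ c
  have hΦ : ∀ n, Φ (Polynomial.X ^ n) = c n := by
    intro n
    have := (Polynomial.basisMonomials ℂ).constr_basis ℂ c n
    simpa [Polynomial.coe_basisMonomials, Polynomial.X_pow_eq_monomial] using this
  have hΦ1 : Φ 1 = c 0 := by simpa using hΦ 0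
  have hΦC : ∀ a, Φ (Polynomial.C a) = a * c 0 := by
    intro a
    rw [← mul_one (Polynomial.C a), ← Polynomial.smul_eq_C_mul, map_smul, hΦ1, smul_eq_mul]
  by_cases hgeom : ∀ n ≤ d, c n = c 0 * (c 1 / c 0) ^ n
  · refine ⟨Pi.single ⟨0, by omega⟩ (c 0), fun _ => c 1 / c 0, fun n hn => ?_⟩
    rw [← Finset.sum_mul, Finset.sum_pi_single']
    simpa using hgeom n hn
  suffices h : ∃ g h : Polynomial ℂ, g.natDegree ≤ d ∧ h.natDegree ≤ d ∧ IsCoprime g h ∧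
      h.coeff d ≠ 0 ∧ Φ g = 0 ∧ Φ h = 0 by
    obtain ⟨g, h, hg, hh, hgh, htop, hΦg, hΦh⟩ := h
    obtain ⟨w, t, hwt⟩ := exists_quadrature_of_pencil (d := d) (by omega : 1 ≤ d) Φ hg hh hgh
      (Or.inr htop) (fun j hj => by obtain rfl : j = 0 := by omega
                                    simpa using hΦg)
      (fun j hj => by obtain rfl : j = 0 := by omega
                      simpa using hΦh)
    exact ⟨w, t, fun n hn => by rw [← hΦ, hwt n hn]⟩
  by_cases h0 : c 0 = 0
  · push Not at hall
    obtain ⟨m, hm, hcm⟩ := hall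
    refine ⟨1, Polynomial.X ^ d - Polynomial.C (c d / c m) * Polynomial.X ^ m, by simp,
      ?_, isCoprime_one_left, ?_, by rw [hΦ1, h0], ?_⟩
    · compute_degree!
      omega
    · simp [Polynomial.coeff_X_pow, hm.ne']
    · rw [map_sub, ← Polynomial.smul_eq_C_mul, map_smul, hΦ, hΦ, smul_eq_mul]
      field_simp
      ring
  have key : ∀ h : Polynomial ℂ, h.natDegree ≤ d → h.eval (c 1 / c 0) ≠ 0 → h.coeff d ≠ 0 →
      Φ h = 0 → ∃ g h : Polynomial ℂ, g.natDegree ≤ d ∧ h.natDegree ≤ d ∧ IsCoprime g h ∧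
      h.coeff d ≠ 0 ∧ Φ g = 0 ∧ Φ h = 0 := by
    intro h hh hev htop hΦh
    refine ⟨Polynomial.X - Polynomial.C (c 1 / c 0), h, by
      rw [Polynomial.natDegree_X_sub_C]; omega, hh, ?_, htop, ?_, hΦh⟩
    · rw [(Polynomial.irreducible_X_sub_C _).coprime_iff_not_dvd, Polynomial.dvd_iff_isRoot]
      exact hev
    · have := hΦ 1
      rw [pow_one] at this
      rw [map_sub, this, hΦC]
      field_simp
      ring
  by_cases hd' : c d = c 0 * (c 1 / c 0) ^ d
  · push Not at hgeom
    obtain ⟨m, hm, hcm⟩ := hgeom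
    have hmd : m ≠ d := by rintro rfl; exact hcm hd'
    refine key (Polynomial.X ^ d + Polynomial.X ^ m - Polynomial.C ((c d + c m) / c 0)) ?_ ?_ ?_ ?_
    · compute_degree!
    · simp only [Polynomial.eval_add, Polynomial.eval_sub, Polynomial.eval_pow,
        Polynomial.eval_X, Polynomial.eval_C]
      intro h1
      apply hcm
      have h2 : c 0 * ((c 1 / c 0) ^ d + (c 1 / c 0) ^ m - (c d + c m) / c 0) = 0 := by
        rw [h1, mul_zero]
      have h3 : c 0 * ((c d + c m) / c 0) = c d + c m := by field_simp
      linear_combination -h3 - h2 - hd'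
    · simp [Polynomial.coeff_X_pow, Polynomial.coeff_C, hmd.symm, show d ≠ 0 by omega]
    · rw [map_sub, map_add, hΦ, hΦ, hΦC]
      field_simp
      ring
  · refine key (Polynomial.X ^ d - Polynomial.C (c d / c 0)) ?_ ?_ ?_ ?_
    · compute_degree!
    · simp only [Polynomial.eval_sub, Polynomial.eval_pow, Polynomial.eval_X, Polynomial.eval_C]
      intro h1
      apply hd'
      rw [sub_eq_zero.1 h1]
      field_simp
    · simp [Polynomial.coeff_X_pow, Polynomial.coeff_C, show d ≠ 0 by omega]
    · rw [map_sub, hΦ, hΦC]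
      field_simp
      ring

/-- A functional on binary forms of degree `2 * m` with nondegenerate Hankel form is a combination
of `m + 1` point evaluations. -/
lemma exists_quadrature_of_hankel_nondegenerate {m : ℕ} (Φ : Polynomial ℂ →ₗ[ℂ] ℂ)
    (hΦ : ∀ p : Polynomial ℂ, p.natDegree ≤ m →
      (∀ j ≤ m, Φ (p * Polynomial.X ^ j) = 0) → p = 0) :
    ∃ w t : Fin (m + 1) → ℂ, ∀ n ≤ 2 * m, Φ (Polynomial.X ^ n) = ∑ i, w i * t i ^ n := by
  let L : Polynomial.degreeLT ℂ (m + 2) →ₗ[ℂ] (Fin m → ℂ) :=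
    LinearMap.pi fun j => Φ ∘ₗ (LinearMap.mulRight ℂ (Polynomial.X ^ (j : ℕ))) ∘ₗ
      (Polynomial.degreeLT ℂ (m + 2)).subtype
  have hfin : Module.finrank ℂ (Polynomial.degreeLT ℂ (m + 2)) = m + 2 := by
    rw [(Polynomial.degreeLTEquiv ℂ (m + 2)).finrank_eq, Module.finrank_fin_fun]
  have : Module.Finite ℂ (Polynomial.degreeLT ℂ (m + 2)) :=
    Module.Finite.equiv (Polynomial.degreeLTEquiv ℂ (m + 2)).symm
  have hker : 1 < Module.finrank ℂ (LinearMap.ker L) := by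
    have h1 := L.finrank_range_add_finrank_ker
    have h2 := Submodule.finrank_le (LinearMap.range L)
    rw [Module.finrank_fin_fun] at h2
    omega
  have : Nontrivial (LinearMap.ker L) :=
    Module.nontrivial_of_finrank_pos (R := ℂ) (zero_lt_one.trans hker)
  obtain ⟨x, hx⟩ := exists_ne (0 : LinearMap.ker L)
  obtain ⟨y, hxy⟩ := exists_linearIndependent_pair_of_one_lt_finrank (R := ℂ)
    (M := LinearMap.ker L) hker hx
  set g : Polynomial ℂ := ((x : Polynomial.degreeLT ℂ (m + 2)) : Polynomial ℂ) with hgdef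
  set h : Polynomial ℂ := ((y : Polynomial.degreeLT ℂ (m + 2)) : Polynomial ℂ) with hhdef
  have hdeg : ∀ z : Polynomial.degreeLT ℂ (m + 2), (z : Polynomial ℂ).natDegree ≤ m + 1 := by
    intro z
    have := Polynomial.mem_degreeLT.1 z.2
    rcases eq_or_ne (z : Polynomial ℂ) 0 with h0 | h0
    · simp [h0]
    · exact Nat.lt_succ_iff.1 ((Polynomial.natDegree_lt_iff_degree_lt h0).2 this)
  have hLz : ∀ z : LinearMap.ker L, ∀ j < m,
      Φ (((z : Polynomial.degreeLT ℂ (m + 2)) : Polynomial ℂ) * Polynomial.X ^ j) = 0 := by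
    intro z j hj
    exact congrFun (LinearMap.mem_ker.1 z.2) ⟨j, hj⟩
  have hindep : ∀ a b : ℂ, a • g + b • h = 0 → a = 0 ∧ b = 0 := by
    intro a b hab
    refine LinearIndependent.pair_iff.1 hxy a b ?_
    ext1; ext1
    simpa using hab
  have hcombo : ∀ u v : Polynomial ℂ, u.natDegree ≤ m → v.natDegree ≤ m →
      (∀ a b : ℂ, a • u + b • v = 0 → a = 0 ∧ b = 0) → ∀ ψ : Polynomial ℂ →ₗ[ℂ] ℂ,
      (∀ p, (∀ a b : ℂ, p = a • u + b • v → ψ p = 0 → ∀ j ≤ m, Φ (p * Polynomial.X ^ j) = 0)) →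
      False := by
    intro u v hu hv huv ψ hψ
    have hz : ∀ a b : ℂ, ψ (a • u + b • v) = 0 → a = 0 ∧ b = 0 := by
      intro a b hab
      refine huv a b (hΦ _ ?_ (hψ _ a b rfl hab))
      exact (Polynomial.natDegree_add_le _ _).trans (max_le
        ((Polynomial.natDegree_smul_le _ _).trans hu) ((Polynomial.natDegree_smul_le _ _).trans hv))
    have h1 := hz (ψ v) (-ψ u) (by simp; ring)
    have h2 := hz 1 0 (by simpa using h1.2)
    exact one_ne_zero h2.1
  have hcop : IsCoprime g h := by
    rw [Polynomial.isCoprime_iff_aeval_ne_zero_of_isAlgClosed ℂ ℂ]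
    intro a
    by_contra hcon
    push Not at hcon
    simp only [Polynomial.coe_aeval_eq_eval] at hcon
    obtain ⟨u, hu⟩ := Polynomial.dvd_iff_isRoot.2 hcon.1
    obtain ⟨v, hv⟩ := Polynomial.dvd_iff_isRoot.2 hcon.2
    have hnat : ∀ f r : Polynomial ℂ, f.natDegree ≤ m + 1 →
        f = (Polynomial.X - Polynomial.C a) * r → r.natDegree ≤ m := by
      intro f r hf hfr
      rcases eq_or_ne r 0 with rfl | hr
      · simp
      · rw [hfr, Polynomial.natDegree_mul (Polynomial.X_sub_C_ne_zero a) hr,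
          Polynomial.natDegree_X_sub_C] at hf
        omega
    refine hcombo u v (hnat g u (hdeg _) hu) (hnat h v (hdeg _) hv) ?_ Φ ?_
    · intro α β hαβ
      refine hindep α β ?_
      rw [hu, hv, ← mul_smul_comm, ← mul_smul_comm, ← mul_add, hαβ, mul_zero]
    · rintro p α β rfl h0 j
      induction j with
      | zero => intro _; simpa using h0
      | succ j ih =>
        intro hj
        have e1 : (α • u + β • v) * Polynomial.X ^ (j + 1) =
            α • (g * Polynomial.X ^ j) + β • (h * Polynomial.X ^ j)
              + a • ((α • u + β • v) * Polynomial.X ^ j) := by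
          rw [hu, hv]
          simp only [Polynomial.smul_eq_C_mul]
          ring
        rw [e1, map_add, map_add, map_smul, map_smul, map_smul, hLz x j (by omega),
          hLz y j (by omega), ih (by omega)]
        simp
  have htop : g.coeff (m + 1) ≠ 0 ∨ h.coeff (m + 1) ≠ 0 := by
    by_contra hcon
    push Not at hcon
    have hnat : ∀ f : Polynomial ℂ, f.natDegree ≤ m + 1 → f.coeff (m + 1) = 0 →
        f.natDegree ≤ m := by
      intro f hf h0
      by_contra hlt
      have : f.natDegree = m + 1 := by omega
      rw [← this, Polynomial.coeff_natDegree, Polynomial.leadingCoeff_eq_zero] at h0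
      rw [h0] at this
      simp at this
    refine hcombo g h (hnat g (hdeg _) hcon.1) (hnat h (hdeg _) hcon.2) hindep
      (Φ ∘ₗ LinearMap.mulRight ℂ (Polynomial.X ^ m)) ?_
    rintro p α β rfl h0 j hj
    rcases hj.lt_or_eq with hj | rfl
    · rw [add_mul, smul_mul_assoc, smul_mul_assoc, map_add, map_smul, map_smul, hLz x j hj,
        hLz y j hj]
      simp
    · simpa using h0
  exact exists_quadrature_of_pencil (by omega) Φ (hdeg _) (hdeg _) hcop htop
    (fun j hj => hLz x j (by omega)) (fun j hj => hLz y j (by omega))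

/-- The forms of degree `d` are spanned by the monomials of degree `d`. -/
lemma MvPolynomial.IsHomogeneous.mem_span_monomials {d : ℕ} {p : MvPolynomial (Fin 3) ℂ}
    (hp : p.IsHomogeneous d) : p ∈ Submodule.span ℂ
      {m : MvPolynomial (Fin 3) ℂ | ∃ i j k, i + j + k = d ∧ m = X 0 ^ i * X 1 ^ j * X 2 ^ k} := by
  rw [p.as_sum]
  refine Submodule.sum_mem _ fun m hm => ?_
  have hdeg := hp.degree_eq_sum_deg_support hm
  have hmon : monomial m (coeff m p) =
      coeff m p • (X 0 ^ m 0 * X 1 ^ m 1 * X 2 ^ m 2 : MvPolynomial (Fin 3) ℂ) := by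
    rw [monomial_eq, Finsupp.prod_fintype _ _ (by simp), Fin.prod_univ_three, smul_eq_C_mul]
  rw [hmon]
  refine Submodule.smul_mem _ _ (Submodule.subset_span ⟨_, _, _, ?_, rfl⟩)
  rw [hdeg, ← Finsupp.degree_apply, Finsupp.degree_eq_sum, Fin.sum_univ_three]

/-- Two linear functionals agreeing on the monomials of degree `d` agree on all forms of
degree `d`. -/
lemma MvPolynomial.IsHomogeneous.linearMap_eq_of_monomials {d : ℕ}
    {Λ₁ Λ₂ : MvPolynomial (Fin 3) ℂ →ₗ[ℂ] ℂ}
    (h : ∀ i j k, i + j + k = d →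
      Λ₁ (X 0 ^ i * X 1 ^ j * X 2 ^ k) = Λ₂ (X 0 ^ i * X 1 ^ j * X 2 ^ k))
    {p : MvPolynomial (Fin 3) ℂ} (hp : p.IsHomogeneous d) : Λ₁ p = Λ₂ p := by
  refine LinearMap.eqOn_span (f := Λ₁) (g := Λ₂) ?_ hp.mem_span_monomials
  rintro _ ⟨i, j, k, hijk, rfl⟩
  exact h i j k hijk

/-- `Λ` restricted to quartic forms is a combination of `n` point evaluations. -/
def HasNodes (n : ℕ) (Λ : MvPolynomial (Fin 3) ℂ →ₗ[ℂ] ℂ) : Prop :=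
  ∃ (w : Fin n → ℂ) (v : Fin n → Fin 3 → ℂ), ∀ p : MvPolynomial (Fin 3) ℂ,
    p.IsHomogeneous 4 → Λ p = ∑ i, w i * eval (v i) p

/-- `q` is apolar to `Λ`: it annihilates `Λ` acting on quartic forms. -/
def Annihilates (Λ : MvPolynomial (Fin 3) ℂ →ₗ[ℂ] ℂ) (q : MvPolynomial (Fin 3) ℂ) : Prop :=
  ∀ p : MvPolynomial (Fin 3) ℂ, p.IsHomogeneous 2 → Λ (q * p) = 0

/-- Evaluation at a point, as a linear functional. -/
noncomputable def evalLin (v : Fin 3 → ℂ) : MvPolynomial (Fin 3) ℂ →ₗ[ℂ] ℂ :=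
  (aeval v : MvPolynomial (Fin 3) ℂ →ₐ[ℂ] ℂ).toLinearMap

@[simp]
lemma evalLin_apply (v : Fin 3 → ℂ) (p : MvPolynomial (Fin 3) ℂ) :
    evalLin v p = eval v p := by
  simp [evalLin, aeval_eq_eval]

lemma hasNodes_zero (n : ℕ) : HasNodes n 0 := ⟨0, 0, by simp⟩

lemma hasNodes_smul_evalLin (a : ℂ) (v : Fin 3 → ℂ) : HasNodes 1 (a • evalLin v) :=
  ⟨fun _ => a, fun _ => v, fun p _ => by simp⟩

lemma HasNodes.add {m n : ℕ} {Λ₁ Λ₂ : MvPolynomial (Fin 3) ℂ →ₗ[ℂ] ℂ} (h₁ : HasNodes m Λ₁)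
    (h₂ : HasNodes n Λ₂) : HasNodes (m + n) (Λ₁ + Λ₂) := by
  obtain ⟨w₁, v₁, h₁⟩ := h₁
  obtain ⟨w₂, v₂, h₂⟩ := h₂
  refine ⟨Fin.append w₁ w₂, Fin.append v₁ v₂, fun p hp => ?_⟩
  rw [Fin.sum_univ_add, LinearMap.add_apply, h₁ p hp, h₂ p hp]
  simp

lemma HasNodes.mono {m n : ℕ} {Λ : MvPolynomial (Fin 3) ℂ →ₗ[ℂ] ℂ} (h : HasNodes m Λ)
    (hmn : m ≤ n) : HasNodes n Λ := by
  have := h.add (hasNodes_zero (n - m))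
  rwa [add_zero, Nat.add_sub_cancel' hmn] at this

lemma HasNodes.of_sub_evalLin {n : ℕ} {Λ : MvPolynomial (Fin 3) ℂ →ₗ[ℂ] ℂ} {a : ℂ}
    {v : Fin 3 → ℂ} (h : HasNodes n (Λ - a • evalLin v)) : HasNodes (n + 1) Λ := by
  have := h.add (hasNodes_smul_evalLin a v)
  rwa [sub_add_cancel] at this

lemma hasNodes_of_moments {n : ℕ} {Λ : MvPolynomial (Fin 3) ℂ →ₗ[ℂ] ℂ} (w : Fin n → ℂ)
    (v : Fin n → Fin 3 → ℂ)
    (h : ∀ i j k, i + j + k = 4 → Λ (X 0 ^ i * X 1 ^ j * X 2 ^ k) =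
      ∑ s, w s * (v s 0 ^ i * v s 1 ^ j * v s 2 ^ k)) : HasNodes n Λ := by
  refine ⟨w, v, fun p hp => ?_⟩
  have := hp.linearMap_eq_of_monomials (Λ₁ := Λ) (Λ₂ := ∑ s, w s • evalLin (v s))
    (fun i j k hijk => by rw [h i j k hijk]; simp)
  rw [this]
  simp

lemma annihilates_of_monomials {Λ : MvPolynomial (Fin 3) ℂ →ₗ[ℂ] ℂ}
    {q : MvPolynomial (Fin 3) ℂ}
    (h : ∀ i j k, i + j + k = 2 → Λ (q * (X 0 ^ i * X 1 ^ j * X 2 ^ k)) = 0) :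
    Annihilates Λ q := by
  intro p hp
  exact hp.linearMap_eq_of_monomials (Λ₁ := Λ ∘ₗ LinearMap.mulLeft ℂ q) (Λ₂ := 0)
    (fun i j k hijk => by simpa using h i j k hijk)

lemma isHomogeneous_monomial_three (i j k : ℕ) :
    (X 0 ^ i * X 1 ^ j * X 2 ^ k : MvPolynomial (Fin 3) ℂ).IsHomogeneous (i + j + k) :=
  ((isHomogeneous_X_pow _ _).mul (isHomogeneous_X_pow _ _)).mul (isHomogeneous_X_pow _ _)

/-- Linear substitution: `p ↦ p ∘ M`. -/
noncomputable def linSubst (M : Matrix (Fin 3) (Fin 3) ℂ) :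
    MvPolynomial (Fin 3) ℂ →ₐ[ℂ] MvPolynomial (Fin 3) ℂ :=
  aeval fun i => ∑ j, C (M i j) * X j

@[simp]
lemma eval_linSubst (M : Matrix (Fin 3) (Fin 3) ℂ) (v : Fin 3 → ℂ)
    (p : MvPolynomial (Fin 3) ℂ) : eval v (linSubst M p) = eval (M.mulVec v) p := by
  induction p using MvPolynomial.induction_on with
  | C a => simp [linSubst]
  | add p q hp hq => rw [map_add, map_add, map_add, hp, hq]
  | mul_X p i hp =>
    rw [map_mul, map_mul, map_mul, hp]
    simp [linSubst, Matrix.mulVec, dotProduct]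

lemma MvPolynomial.IsHomogeneous.linSubst {d : ℕ} {p : MvPolynomial (Fin 3) ℂ}
    (hp : p.IsHomogeneous d) (M : Matrix (Fin 3) (Fin 3) ℂ) :
    (linSubst M p).IsHomogeneous d := by
  have := hp.aeval (n := 1) (fun i => ∑ j, C (M i j) * X j)
    (fun i => IsHomogeneous.sum _ _ _ fun j _ => isHomogeneous_C_mul_X _ _)
  rwa [one_mul] at this

lemma linSubst_linSubst_inv {M : Matrix (Fin 3) (Fin 3) ℂ} (hM : M.det ≠ 0)
    (p : MvPolynomial (Fin 3) ℂ) : linSubst M (linSubst M⁻¹ p) = p := by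
  refine MvPolynomial.funext fun v => ?_
  rw [eval_linSubst, eval_linSubst, Matrix.mulVec_mulVec,
    Matrix.nonsing_inv_mul _ (isUnit_iff_ne_zero.2 hM), Matrix.one_mulVec]

/-- The functional `Λ` in the coordinates given by the rows of `M`. -/
noncomputable def changeCoords (M : Matrix (Fin 3) (Fin 3) ℂ)
    (Λ : MvPolynomial (Fin 3) ℂ →ₗ[ℂ] ℂ) : MvPolynomial (Fin 3) ℂ →ₗ[ℂ] ℂ :=
  Λ ∘ₗ (linSubst M).toLinearMap

@[simp]
lemma changeCoords_apply (M : Matrix (Fin 3) (Fin 3) ℂ)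
    (Λ : MvPolynomial (Fin 3) ℂ →ₗ[ℂ] ℂ) (p : MvPolynomial (Fin 3) ℂ) :
    changeCoords M Λ p = Λ (linSubst M p) := rfl

lemma HasNodes.of_changeCoords {n : ℕ} {Λ : MvPolynomial (Fin 3) ℂ →ₗ[ℂ] ℂ}
    {M : Matrix (Fin 3) (Fin 3) ℂ} (hM : M.det ≠ 0) (h : HasNodes n (changeCoords M Λ)) :
    HasNodes n Λ := by
  obtain ⟨w, v, h⟩ := h
  refine ⟨w, fun i => M⁻¹.mulVec (v i), fun p hp => ?_⟩
  have := h _ (hp.linSubst M⁻¹)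
  simpa [linSubst_linSubst_inv hM] using this

lemma Annihilates.changeCoords {Λ : MvPolynomial (Fin 3) ℂ →ₗ[ℂ] ℂ}
    {M : Matrix (Fin 3) (Fin 3) ℂ} {q : MvPolynomial (Fin 3) ℂ}
    (h : Annihilates Λ (linSubst M q)) : Annihilates (changeCoords M Λ) q := by
  intro p hp
  rw [changeCoords_apply, map_mul]
  exact h _ (hp.linSubst M)

lemma Annihilates.of_changeCoords {Λ : MvPolynomial (Fin 3) ℂ →ₗ[ℂ] ℂ}
    {M : Matrix (Fin 3) (Fin 3) ℂ} (hM : M.det ≠ 0) {q : MvPolynomial (Fin 3) ℂ}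
    (h : Annihilates (_root_.changeCoords M Λ) q) : Annihilates Λ (linSubst M q) := by
  intro p hp
  have := h _ (hp.linSubst M⁻¹)
  rwa [changeCoords_apply, map_mul, linSubst_linSubst_inv hM] at this

lemma Annihilates.exists_conic_moments {Λ : MvPolynomial (Fin 3) ℂ →ₗ[ℂ] ℂ}
    (h : Annihilates Λ (X 0 * X 2 - X 1 ^ 2)) :
    ∃ c : ℕ → ℂ, ∀ i j k, i + j + k = 4 → Λ (X 0 ^ i * X 1 ^ j * X 2 ^ k) = c (j + 2 * k) := by
  have step : ∀ i j k, i + (j + 2) + k = 4 → Λ (X 0 ^ i * X 1 ^ (j + 2) * X 2 ^ k) =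
      Λ (X 0 ^ (i + 1) * X 1 ^ j * X 2 ^ (k + 1)) := by
    intro i j k hijk
    have := h (X 0 ^ i * X 1 ^ j * X 2 ^ k)
      (by simpa [show i + j + k = 2 by omega] using isHomogeneous_monomial_three i j k)
    rw [sub_mul, map_sub, sub_eq_zero] at this
    convert this.symm using 2 <;> ring
  refine ⟨fun n => Λ (X 0 ^ (4 - n % 2 - n / 2) * X 1 ^ (n % 2) * X 2 ^ (n / 2)), ?_⟩
  intro i j
  induction j using Nat.strong_induction_on generalizing i with
  | _ j ih =>
    intro k hijk
    match j with
    | 0 =>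
      dsimp only
      rw [show (0 + 2 * k) % 2 = 0 by omega, show (0 + 2 * k) / 2 = k by omega,
        show 4 - 0 - k = i by omega]
    | 1 =>
      dsimp only
      rw [show (1 + 2 * k) % 2 = 1 by omega, show (1 + 2 * k) / 2 = k by omega,
        show 4 - 1 - k = i by omega]
    | j + 2 =>
      rw [step i j k hijk, ih j (by omega) (i + 1) (k + 1) (by omega),
        show j + 2 * (k + 1) = j + 2 + 2 * k by ring]

/-- A functional annihilated by a smooth conic comes from a binary octic, hence has `8` nodes. -/
lemma hasNodes_eight_of_smooth_conic {Λ : MvPolynomial (Fin 3) ℂ →ₗ[ℂ] ℂ}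
    (h : Annihilates Λ (X 0 * X 2 - X 1 ^ 2)) : HasNodes 8 Λ := by
  obtain ⟨c, hc⟩ := h.exists_conic_moments
  rcases exists_moments_or_eq_zero (d := 8) (by norm_num) c with ⟨w, t, hwt⟩ | h0
  · refine hasNodes_of_moments w (fun s => ![1, t s, t s ^ 2]) fun i j k hijk => ?_
    rw [hc i j k hijk, hwt _ (by omega)]
    refine Finset.sum_congr rfl fun s _ => ?_
    simp [pow_add, pow_mul]
  · refine HasNodes.mono (m := 1) ?_ (by norm_num)
    refine hasNodes_of_moments (fun _ => c 8) (fun _ => ![0, 0, 1]) fun i j k hijk => ?_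
    rw [hc i j k hijk]
    by_cases hk : k = 4
    · obtain ⟨rfl, rfl⟩ : i = 0 ∧ j = 0 := by omega
      simp [hk]
    · rw [h0 _ (by omega)]
      rcases Nat.eq_zero_or_pos i with rfl | hi
      · have : j ≠ 0 := by omega
        simp [this]
      · simp [hi.ne']

/-- If a smooth conic is the only one annihilating `Λ`, then `5` nodes suffice. -/
lemma hasNodes_five_of_unique_smooth_conic {Λ : MvPolynomial (Fin 3) ℂ →ₗ[ℂ] ℂ}
    (h : Annihilates Λ (X 0 * X 2 - X 1 ^ 2))
    (huniq : ∀ r : MvPolynomial (Fin 3) ℂ, r.IsHomogeneous 2 → Annihilates Λ r →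
      ∃ s : ℂ, r = s • (X 0 * X 2 - X 1 ^ 2)) : HasNodes 5 Λ := by
  obtain ⟨c, hc⟩ := h.exists_conic_moments
  let Φ : Polynomial ℂ →ₗ[ℂ] ℂ := (Polynomial.basisMonomials ℂ).constr ℂ c
  have hΦ : ∀ n, Φ (Polynomial.X ^ n) = c n := by
    intro n
    have := (Polynomial.basisMonomials ℂ).constr_basis ℂ c n
    simpa [Polynomial.coe_basisMonomials, Polynomial.X_pow_eq_monomial] using this
  obtain ⟨w, t, hwt⟩ := exists_quadrature_of_hankel_nondegenerate (m := 4) Φ (by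
    intro p hp hpj
    have hpsum : p = ∑ n ∈ Finset.range 5, p.coeff n • Polynomial.X ^ n := by
      conv_lhs => rw [p.as_sum_range' 5 (by omega)]
      simp [Polynomial.smul_eq_C_mul, Polynomial.C_mul_X_pow_eq_monomial]
    have hc' : ∀ j ≤ 4, p.coeff 0 * c j + p.coeff 1 * c (1 + j) + p.coeff 2 * c (2 + j) +
        p.coeff 3 * c (3 + j) + p.coeff 4 * c (4 + j) = 0 := by
      intro j hj
      have := hpj j hj
      rw [hpsum, Finset.sum_mul, map_sum] at this
      simpa only [smul_mul_assoc, ← pow_add, map_smul, hΦ, Finset.sum_range_succ,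
        Finset.sum_range_zero, smul_eq_mul, zero_add] using this
    obtain ⟨s, hs⟩ := huniq (p.coeff 0 • (X 0 ^ 2 * X 1 ^ 0 * X 2 ^ 0) +
      p.coeff 1 • (X 0 ^ 1 * X 1 ^ 1 * X 2 ^ 0) + p.coeff 2 • (X 0 ^ 0 * X 1 ^ 2 * X 2 ^ 0) +
      p.coeff 3 • (X 0 ^ 0 * X 1 ^ 1 * X 2 ^ 1) + p.coeff 4 • (X 0 ^ 0 * X 1 ^ 0 * X 2 ^ 2))
      (by
        simp only [smul_eq_C_mul]
        exact ((((isHomogeneous_monomial_three 2 0 0).C_mul _).add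
          ((isHomogeneous_monomial_three 1 1 0).C_mul _)).add
          ((isHomogeneous_monomial_three 0 2 0).C_mul _)).add
          ((isHomogeneous_monomial_three 0 1 1).C_mul _) |>.add
          ((isHomogeneous_monomial_three 0 0 2).C_mul _))
      (annihilates_of_monomials fun i j k hijk => by
        have hmul : ∀ a b d : ℕ, (X 0 ^ a * X 1 ^ b * X 2 ^ d * (X 0 ^ i * X 1 ^ j * X 2 ^ k) :
            MvPolynomial (Fin 3) ℂ) = X 0 ^ (a + i) * X 1 ^ (b + j) * X 2 ^ (d + k) := by
          intros; ring
        simp only [add_mul, smul_mul_assoc, hmul, map_add, map_smul, smul_eq_mul]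
        rw [hc _ _ _ (by omega), hc _ _ _ (by omega), hc _ _ _ (by omega), hc _ _ _ (by omega),
          hc _ _ _ (by omega)]
        have := hc' (j + 2 * k) (by omega)
        rw [← this]
        ring_nf)
    have hev : ∀ x y z : ℂ, p.coeff 0 * x ^ 2 + p.coeff 1 * (x * y) + p.coeff 2 * y ^ 2 +
        p.coeff 3 * (y * z) + p.coeff 4 * z ^ 2 = s * (x * z - y ^ 2) := by
      intro x y z
      simpa [smul_eval] using congrArg (eval ![x, y, z]) hs
    have e0 := hev 1 0 0
    have e4 := hev 0 0 1
    have es := hev 1 0 1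
    have e2 := hev 0 1 0
    have e1 := hev 1 1 0
    have e3 := hev 0 1 1
    ring_nf at e0 e4 es e2 e1 e3
    rw [hpsum]
    have z0 : p.coeff 0 = 0 := e0
    have z4 : p.coeff 4 = 0 := e4
    have zs : s = 0 := by linear_combination z0 + z4 - es
    have z2 : p.coeff 2 = 0 := by linear_combination e2 - zs
    have z1 : p.coeff 1 = 0 := by linear_combination e1 - zs - z0 - z2
    have z3 : p.coeff 3 = 0 := by linear_combination e3 - zs - z4 - z2
    simp [Finset.sum_range_succ, z0, z1, z2, z3, z4])
  refine hasNodes_of_moments w (fun s => ![1, t s, t s ^ 2]) fun i j k hijk => ?_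
  rw [hc i j k hijk, ← hΦ, hwt _ (by omega)]
  refine Finset.sum_congr rfl fun s _ => ?_
  simp [pow_add, pow_mul]

/-- A functional annihilated by a pair of distinct lines has `7` nodes, provided the component on
one line is not concentrated at the intersection point. -/
lemma hasNodes_seven_of_line_pair_aux {Λ : MvPolynomial (Fin 3) ℂ →ₗ[ℂ] ℂ}
    (h : ∀ i j k, i + 1 + (j + 1) + k = 4 → Λ (X 0 ^ (i + 1) * X 1 ^ (j + 1) * X 2 ^ k) = 0)
    {w t : Fin 3 → ℂ}
    (hwt : ∀ n ≤ 3, Λ (X 0 ^ 0 * X 1 ^ (4 - n) * X 2 ^ n) = ∑ i, w i * t i ^ n) :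
    HasNodes 7 Λ := by
  have h3 : HasNodes 3 (∑ s, w s • evalLin ![0, 1, t s]) :=
    ⟨w, fun s => ![0, 1, t s], fun p _ => by simp⟩
  suffices h4 : HasNodes 4 (Λ - ∑ s, w s • evalLin ![0, 1, t s]) by
    have := h4.add h3
    rwa [sub_add_cancel] at this
  set Λ' := Λ - ∑ s, w s • evalLin ![0, 1, t s] with hΛ'
  have hval : ∀ i j k, Λ' (X 0 ^ i * X 1 ^ j * X 2 ^ k) =
      Λ (X 0 ^ i * X 1 ^ j * X 2 ^ k) - ∑ s, w s * (0 ^ i * t s ^ k) := by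
    intro i j k
    simp [hΛ']
  have hzero : ∀ i j k, i + (j + 1) + k = 4 → Λ' (X 0 ^ i * X 1 ^ (j + 1) * X 2 ^ k) = 0 := by
    intro i j k hijk
    rw [hval]
    cases i with
    | zero =>
      have := hwt k (by omega)
      rw [show 4 - k = j + 1 by omega] at this
      rw [this]
      simp
    | succ i => rw [h i j k hijk]; simp
  rcases exists_moments_or_eq_zero (d := 4) (by norm_num)
    (fun n => Λ' (X 0 ^ (4 - n) * X 1 ^ 0 * X 2 ^ n)) with ⟨w', t', hwt'⟩ | h0
  · refine hasNodes_of_moments w' (fun s => ![1, 0, t' s]) fun i j k hijk => ?_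
    cases j with
    | zero =>
      have := hwt' k (by omega)
      rw [show 4 - k = i by omega] at this
      rw [this]
      simp
    | succ j => rw [hzero i j k hijk]; simp
  · refine HasNodes.mono (m := 1) ?_ (by norm_num)
    refine hasNodes_of_moments (fun _ => Λ' (X 0 ^ 0 * X 1 ^ 0 * X 2 ^ 4))
      (fun _ => ![0, 0, 1]) fun i j k hijk => ?_
    cases j with
    | zero =>
      cases i with
      | zero => obtain rfl : k = 4 := by omega
                simp
      | succ i =>
        have := h0 k (by omega)
        rw [show 4 - k = i + 1 by omega] at this
        rw [this]
        simp
    | succ j => rw [hzero i j k hijk]; simp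

/-- A functional annihilated by a pair of distinct lines has `7` nodes. -/
lemma hasNodes_seven_of_line_pair {Λ : MvPolynomial (Fin 3) ℂ →ₗ[ℂ] ℂ}
    (h : Annihilates Λ (X 0 * X 1)) : HasNodes 7 Λ := by
  have hΛ : ∀ i j k, i + 1 + (j + 1) + k = 4 →
      Λ (X 0 ^ (i + 1) * X 1 ^ (j + 1) * X 2 ^ k) = 0 := by
    intro i j k hijk
    have := h (X 0 ^ i * X 1 ^ j * X 2 ^ k)
      (by simpa [show i + j + k = 2 by omega] using isHomogeneous_monomial_three i j k)
    convert this using 2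
    ring
  rcases exists_moments_or_eq_zero (d := 3) (by norm_num)
    (fun n => Λ (X 0 ^ 0 * X 1 ^ (4 - n) * X 2 ^ n)) with ⟨w, t, hwt⟩ | h1
  · exact hasNodes_seven_of_line_pair_aux hΛ hwt
  rcases exists_moments_or_eq_zero (d := 3) (by norm_num)
    (fun n => Λ (X 0 ^ (4 - n) * X 1 ^ 0 * X 2 ^ n)) with ⟨w, t, hwt⟩ | h0
  · have hswap : ∀ i j k, changeCoords !![0, 1, 0; 1, 0, 0; 0, 0, 1] Λ
        (X 0 ^ i * X 1 ^ j * X 2 ^ k) = Λ (X 0 ^ j * X 1 ^ i * X 2 ^ k) := by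
      intro i j k
      simp only [changeCoords_apply, map_mul, map_pow, linSubst, aeval_X, Fin.sum_univ_three]
      simp
      ring_nf
    refine HasNodes.of_changeCoords (M := !![0, 1, 0; 1, 0, 0; 0, 0, 1])
      (by simp [Matrix.det_fin_three]) ?_
    refine hasNodes_seven_of_line_pair_aux (w := w) (t := t) (fun i j k hijk => ?_) fun n hn => ?_
    · rw [hswap]; exact hΛ j i k (by omega)
    · rw [hswap]; exact hwt n hn
  set a := Λ (X 0 ^ 1 * X 1 ^ 0 * X 2 ^ 3)
  set b := Λ (X 0 ^ 0 * X 1 ^ 1 * X 2 ^ 3)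
  set e := Λ (X 0 ^ 0 * X 1 ^ 0 * X 2 ^ 4)
  rcases exists_moments_or_eq_zero (d := 4) (by norm_num)
    (fun n => if n = 3 then 1 else if n = 4 then e else 0) with ⟨w, t, hwt⟩ | hcon
  · refine HasNodes.mono (m := 4) ?_ (by norm_num)
    refine hasNodes_of_moments w (fun s => ![a, b, t s]) fun i j k hijk => ?_
    have hsum : ∑ s, w s * (![a, b, t s] 0 ^ i * ![a, b, t s] 1 ^ j * ![a, b, t s] 2 ^ k) =
        a ^ i * b ^ j * ∑ s, w s * t s ^ k := by
      rw [Finset.mul_sum]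
      refine Finset.sum_congr rfl fun s _ => ?_
      simp
      ring
    rw [hsum, ← hwt k (by omega)]
    match i, j with
    | 0, 0 => obtain rfl : k = 4 := by omega
              simp [e]
    | 0, j + 1 =>
      by_cases hk : k = 3
      · obtain rfl : j = 0 := by omega
        subst hk
        simp [b]
      · have := h1 k (by omega)
        rw [show 4 - k = j + 1 by omega] at this
        rw [this, if_neg hk, if_neg (by omega), mul_zero]
    | i + 1, 0 =>
      by_cases hk : k = 3
      · obtain rfl : i = 0 := by omega
        subst hk
        simp [a]
      · have := h0 k (by omega)
        rw [show 4 - k = i + 1 by omega] at this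
        rw [this, if_neg hk, if_neg (by omega), mul_zero]
    | i + 1, j + 1 =>
      rw [hΛ i j k hijk, if_neg (by omega), if_neg (by omega), mul_zero]
  · exact absurd (hcon 3 (by norm_num)) (by simp)

lemma eq_of_add_eq_two {i j k : ℕ} (h : i + j + k = 2) :
    (i = 2 ∧ j = 0 ∧ k = 0) ∨ (i = 0 ∧ j = 2 ∧ k = 0) ∨ (i = 0 ∧ j = 0 ∧ k = 2) ∨
      (i = 1 ∧ j = 1 ∧ k = 0) ∨ (i = 1 ∧ j = 0 ∧ k = 1) ∨ (i = 0 ∧ j = 1 ∧ k = 1) := by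
  omega

/-- A ternary quadratic form, as a quadratic form on `ℂ³`. -/
lemma MvPolynomial.IsHomogeneous.exists_quadraticForm {q : MvPolynomial (Fin 3) ℂ}
    (hq : q.IsHomogeneous 2) :
    ∃ Q : QuadraticForm ℂ (Fin 3 → ℂ), ∀ v, Q v = eval v q := by
  refine Submodule.span_induction (p := fun q _ => ∃ Q : QuadraticForm ℂ (Fin 3 → ℂ),
    ∀ v, Q v = eval v q) ?_ ⟨0, by simp⟩ ?_ ?_ hq.mem_span_monomials
  · rintro _ ⟨i, j, k, h, rfl⟩
    obtain ⟨a, b, hab⟩ : ∃ a b : Fin 3,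
        (X 0 ^ i * X 1 ^ j * X 2 ^ k : MvPolynomial (Fin 3) ℂ) = X a * X b := by
      rcases eq_of_add_eq_two h with h | h | h | h | h | h <;> obtain ⟨rfl, rfl, rfl⟩ := h
      exacts [⟨0, 0, by ring⟩, ⟨1, 1, by ring⟩, ⟨2, 2, by ring⟩, ⟨0, 1, by ring⟩,
        ⟨0, 2, by ring⟩, ⟨1, 2, by ring⟩]
    exact ⟨QuadraticMap.linMulLin (LinearMap.proj a) (LinearMap.proj b), fun v => by simp [hab]⟩
  · rintro p q - - ⟨P, hP⟩ ⟨Q, hQ⟩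
    exact ⟨P + Q, fun v => by simp [hP, hQ]⟩
  · rintro a q - ⟨Q, hQ⟩
    exact ⟨a • Q, fun v => by simp [hQ, smul_eval]⟩

/-- A quadratic form over `ℂ` in three variables is, in suitable coordinates, a sum of distinct
squares of coordinates. -/
lemma MvPolynomial.IsHomogeneous.exists_diagonal {q : MvPolynomial (Fin 3) ℂ}
    (hq : q.IsHomogeneous 2) :
    ∃ (M : Matrix (Fin 3) (Fin 3) ℂ) (ε : Fin 3 → ℂ), M.det ≠ 0 ∧ (∀ i, ε i = 0 ∨ ε i = 1) ∧
      ∀ v, eval v q = ∑ i, ε i * M.mulVec v i ^ 2 := by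
  obtain ⟨Q, hQ⟩ := hq.exists_quadraticForm
  have hw := QuadraticForm.equivalent_weightedSumSquares Q
  rw [Module.finrank_fin_fun] at hw
  obtain ⟨w, ⟨e⟩⟩ := hw
  have hs : ∀ i, ∃ s ε : ℂ, s ≠ 0 ∧ (ε = 0 ∨ ε = 1) ∧ w i = ε * s ^ 2 := by
    intro i
    rcases eq_or_ne (w i) 0 with h0 | h0
    · exact ⟨1, 0, one_ne_zero, Or.inl rfl, by simp [h0]⟩
    · obtain ⟨s, hs⟩ := IsAlgClosed.exists_pow_nat_eq (w i) (n := 2) (by norm_num)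
      refine ⟨s, 1, ?_, Or.inr rfl, by simp [hs]⟩
      rintro rfl
      exact h0 (by simpa using hs.symm)
  choose s ε hs0 hε hw using hs
  refine ⟨Matrix.diagonal s * LinearMap.toMatrix' (e.toLinearEquiv : (Fin 3 → ℂ) →ₗ[ℂ] _), ε,
    ?_, hε, fun v => ?_⟩
  · rw [Matrix.det_mul, Matrix.det_diagonal, LinearMap.det_toMatrix']
    exact mul_ne_zero (Finset.prod_ne_zero_iff.2 fun i _ => hs0 i)
      e.toLinearEquiv.isUnit_det'.ne_zero
  · rw [← hQ, ← e.map_app v, QuadraticMap.weightedSumSquares_apply]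
    refine Finset.sum_congr rfl fun i _ => ?_
    rw [← Matrix.mulVec_mulVec, Matrix.mulVec_diagonal, LinearMap.toMatrix'_mulVec, hw]
    simp
    ring

/-- Classification of plane conics over `ℂ`. -/
lemma exists_conic_normal_form {q : MvPolynomial (Fin 3) ℂ}
    (hq : q.IsHomogeneous 2) :
    ∃ M : Matrix (Fin 3) (Fin 3) ℂ, M.det ≠ 0 ∧ (q = linSubst M (X 0 * X 2 - X 1 ^ 2) ∨
      q = linSubst M (X 0 * X 1) ∨ q = linSubst M (X 2 ^ 2) ∨ q = 0) := by
  obtain ⟨M, ε, hM, hε, hq⟩ := hq.exists_diagonal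
  suffices h : ∃ N : Matrix (Fin 3) (Fin 3) ℂ, N.det ≠ 0 ∧
      ((∀ u, ∑ i, ε i * u i ^ 2 = N.mulVec u 0 * N.mulVec u 2 - N.mulVec u 1 ^ 2) ∨
      (∀ u, ∑ i, ε i * u i ^ 2 = N.mulVec u 0 * N.mulVec u 1) ∨
      (∀ u, ∑ i, ε i * u i ^ 2 = N.mulVec u 2 ^ 2) ∨ ∀ u : Fin 3 → ℂ, ∑ i, ε i * u i ^ 2 = 0) by
    obtain ⟨N, hN, h⟩ := h
    refine ⟨N * M, by rw [Matrix.det_mul]; exact mul_ne_zero hN hM, ?_⟩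
    rcases h with h | h | h | h
    · exact Or.inl (MvPolynomial.funext fun v => by simp [hq, h])
    · exact Or.inr (Or.inl (MvPolynomial.funext fun v => by simp [hq, h]))
    · exact Or.inr (Or.inr (Or.inl (MvPolynomial.funext fun v => by simp [hq, h])))
    · exact Or.inr (Or.inr (Or.inr (MvPolynomial.funext fun v => by rw [hq, h, map_zero])))
  have hI := Complex.I_sq
  have hI0 := Complex.I_ne_zero
  simp only [Matrix.mulVec, dotProduct, Fin.sum_univ_three, Matrix.det_fin_three]
  rcases hε 0 with h0 | h0 <;> rcases hε 1 with h1 | h1 <;> rcases hε 2 with h2 | h2 <;>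
    simp only [h0, h1, h2]
  · exact ⟨1, by simp, by simp⟩
  · exact ⟨1, by simp, by simp⟩
  · exact ⟨!![1, 0, 0; 0, 0, 1; 0, 1, 0], by simp, by simp⟩
  · exact ⟨!![0, 1, Complex.I; 0, 1, -Complex.I; 1, 0, 0], by simp; grind,
      Or.inr (Or.inl fun u => by simp; grind)⟩
  · exact ⟨!![0, 1, 0; 0, 0, 1; 1, 0, 0], by simp, by simp⟩
  · exact ⟨!![1, 0, Complex.I; 1, 0, -Complex.I; 0, 1, 0], by simp,
      Or.inr (Or.inl fun u => by simp; grind)⟩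
  · exact ⟨!![1, Complex.I, 0; 1, -Complex.I, 0; 0, 0, 1], by simp; grind,
      Or.inr (Or.inl fun u => by simp; grind)⟩
  · exact ⟨!![1, Complex.I, 0; 0, 0, Complex.I; 1, -Complex.I, 0], by simp,
      Or.inl fun u => by simp; grind⟩

lemma linSubst_injective {M : Matrix (Fin 3) (Fin 3) ℂ} (hM : M.det ≠ 0) :
    Function.Injective (linSubst M) := by
  intro p q hpq
  refine MvPolynomial.funext fun v => ?_
  have := congrArg (eval (M⁻¹.mulVec v)) hpq
  rwa [eval_linSubst, eval_linSubst, Matrix.mulVec_mulVec,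
    Matrix.mul_nonsing_inv _ (isUnit_iff_ne_zero.2 hM), Matrix.one_mulVec] at this

/-- `Λ` is nondegenerate: no nonzero quadratic form is apolar to it. -/
def Nondegenerate (Λ : MvPolynomial (Fin 3) ℂ →ₗ[ℂ] ℂ) : Prop :=
  ∀ r : MvPolynomial (Fin 3) ℂ, r.IsHomogeneous 2 → Annihilates Λ r → r = 0

lemma Nondegenerate.changeCoords {Λ : MvPolynomial (Fin 3) ℂ →ₗ[ℂ] ℂ} (h : Nondegenerate Λ)
    {M : Matrix (Fin 3) (Fin 3) ℂ} (hM : M.det ≠ 0) : Nondegenerate (changeCoords M Λ) := by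
  intro r hr hann
  refine linSubst_injective hM ?_
  rw [map_zero]
  exact h _ (hr.linSubst M) (hann.of_changeCoords hM)

/-- `q` is the square of a linear form. -/
def IsLinearSquare (q : MvPolynomial (Fin 3) ℂ) : Prop :=
  ∃ n : Fin 3 → ℂ, q = (∑ i, C (n i) * X i) ^ 2

lemma not_isLinearSquare {q : MvPolynomial (Fin 3) ℂ} (u v : Fin 3 → ℂ)
    (h : (eval (u + v) q - eval u q - eval v q) ^ 2 ≠ 4 * eval u q * eval v q) :
    ¬ IsLinearSquare q := by
  rintro ⟨n, rfl⟩
  refine h ?_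
  simp only [Fin.sum_univ_three, map_pow, map_add, map_mul, eval_C, eval_X, Pi.add_apply]
  ring

lemma hasNodes_seven_of_linSubst {Λ : MvPolynomial (Fin 3) ℂ →ₗ[ℂ] ℂ}
    (M : Matrix (Fin 3) (Fin 3) ℂ) (hM : M.det ≠ 0)
    (h : Annihilates Λ (linSubst M (X 0 * X 1))) : HasNodes 7 Λ :=
  (hasNodes_seven_of_line_pair h.changeCoords).of_changeCoords hM

lemma linSubst_X_two_sq (M : Matrix (Fin 3) (Fin 3) ℂ) :
    linSubst M (X 2 ^ 2) = (∑ i, C (M 2 i) * X i) ^ 2 := by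
  simp [linSubst]

lemma isLinearSquare_zero : IsLinearSquare 0 := ⟨0, by simp⟩

lemma hasNodes_eight_of_not_isLinearSquare {Λ : MvPolynomial (Fin 3) ℂ →ₗ[ℂ] ℂ}
    {q : MvPolynomial (Fin 3) ℂ} (hq : q.IsHomogeneous 2) (hsq : ¬ IsLinearSquare q)
    (h : Annihilates Λ q) : HasNodes 8 Λ := by
  obtain ⟨M, hM, rfl | rfl | rfl | rfl⟩ := exists_conic_normal_form hq
  · exact (hasNodes_eight_of_smooth_conic h.changeCoords).of_changeCoords hM
  · exact (hasNodes_seven_of_linSubst M hM h).mono (by norm_num)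
  · exact (hsq ⟨_, linSubst_X_two_sq M⟩).elim
  · exact (hsq isLinearSquare_zero).elim

lemma hasNodes_seven_of_unique {Λ : MvPolynomial (Fin 3) ℂ →ₗ[ℂ] ℂ}
    {q : MvPolynomial (Fin 3) ℂ} (hq : q.IsHomogeneous 2) (hsq : ¬ IsLinearSquare q)
    (h : Annihilates Λ q)
    (huniq : ∀ r : MvPolynomial (Fin 3) ℂ, r.IsHomogeneous 2 → Annihilates Λ r →
      ∃ s : ℂ, r = s • q) : HasNodes 7 Λ := by
  obtain ⟨M, hM, rfl | rfl | rfl | rfl⟩ := exists_conic_normal_form hq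
  · refine ((hasNodes_five_of_unique_smooth_conic h.changeCoords fun r hr hann => ?_).mono
      (by norm_num)).of_changeCoords hM
    obtain ⟨s, hs⟩ := huniq _ (hr.linSubst M) (hann.of_changeCoords hM)
    exact ⟨s, linSubst_injective hM (by rw [hs, map_smul])⟩
  · exact hasNodes_seven_of_linSubst M hM h
  · exact (hsq ⟨_, linSubst_X_two_sq M⟩).elim
  · exact (hsq isLinearSquare_zero).elim

/-- If the contraction of `Λ` by `q` is evaluation at `l`, and `q` does not vanish at `l`, then
subtracting a suitable multiple of the evaluation at `l` from `Λ` makes `q` apolar. -/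
lemma annihilates_sub_evalLin {Λ : MvPolynomial (Fin 3) ℂ →ₗ[ℂ] ℂ}
    {q : MvPolynomial (Fin 3) ℂ} {l : Fin 3 → ℂ}
    (h : ∀ p : MvPolynomial (Fin 3) ℂ, p.IsHomogeneous 2 → Λ (q * p) = eval l p)
    (hl : eval l q ≠ 0) : Annihilates (Λ - (eval l q)⁻¹ • evalLin l) q := by
  intro p hp
  simp [h p hp, hl]

lemma Nondegenerate.hasNodes_eight {Λ : MvPolynomial (Fin 3) ℂ →ₗ[ℂ] ℂ} (hΛ : Nondegenerate Λ)
    {q : MvPolynomial (Fin 3) ℂ} (hq : q.IsHomogeneous 2) (hsq : ¬ IsLinearSquare q)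
    {l : Fin 3 → ℂ}
    (h : ∀ p : MvPolynomial (Fin 3) ℂ, p.IsHomogeneous 2 → Λ (q * p) = eval l p)
    (hl : eval l q ≠ 0) : HasNodes 8 Λ := by
  refine (hasNodes_seven_of_unique hq hsq (annihilates_sub_evalLin h hl)
    fun r hr hann => ⟨(eval l q)⁻¹ * eval l r, ?_⟩).of_sub_evalLin
  rw [← sub_eq_zero]
  have hhom : (r - ((eval l q)⁻¹ * eval l r) • q).IsHomogeneous 2 :=
    (homogeneousSubmodule (Fin 3) ℂ 2).sub_mem hr (Submodule.smul_mem _ _ hq)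
  refine hΛ _ hhom fun p hp => ?_
  have := hann p hp
  simp only [LinearMap.sub_apply, LinearMap.smul_apply, evalLin_apply, map_mul, smul_eq_mul] at this
  rw [sub_mul, map_sub, smul_mul_assoc, map_smul, h p hp, smul_eq_mul]
  linear_combination this

/-- The quadratic form with the given coefficients. -/
noncomputable def conic (a b c d e f : ℂ) : MvPolynomial (Fin 3) ℂ :=
  C a * X 0 ^ 2 + C b * X 1 ^ 2 + C c * X 2 ^ 2 + C d * (X 0 * X 1) + C e * (X 0 * X 2) +
    C f * (X 1 * X 2)

lemma isHomogeneous_conic (a b c d e f : ℂ) : (conic a b c d e f).IsHomogeneous 2 := by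
  have h1 : ∀ (t : ℂ) (i : Fin 3), (C t * X i ^ 2 : MvPolynomial (Fin 3) ℂ).IsHomogeneous 2 :=
    fun t i => by simpa using (isHomogeneous_C _ t).mul (isHomogeneous_X_pow i 2)
  have h2 : ∀ (t : ℂ) (i j : Fin 3), (C t * (X i * X j) : MvPolynomial (Fin 3) ℂ).IsHomogeneous 2 :=
    fun t i j => by
      simpa using (isHomogeneous_C _ t).mul ((isHomogeneous_X ℂ i).mul (isHomogeneous_X ℂ j))
  exact (((((h1 _ _).add (h1 _ _)).add (h1 _ _)).add (h2 _ _ _)).add (h2 _ _ _)).add (h2 _ _ _)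

lemma eval_conic (a b c d e f : ℂ) (v : Fin 3 → ℂ) : eval v (conic a b c d e f) =
    a * v 0 ^ 2 + b * v 1 ^ 2 + c * v 2 ^ 2 + d * (v 0 * v 1) + e * (v 0 * v 2) +
      f * (v 1 * v 2) := by
  simp [conic]

/-- The moments of a functional. -/
noncomputable def moment (Λ : MvPolynomial (Fin 3) ℂ →ₗ[ℂ] ℂ) (i j k : ℕ) : ℂ :=
  Λ (X 0 ^ i * X 1 ^ j * X 2 ^ k)

lemma map_conic_mul_monomial (Λ : MvPolynomial (Fin 3) ℂ →ₗ[ℂ] ℂ) (a b c d e f : ℂ)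
    (i j k : ℕ) : Λ (conic a b c d e f * (X 0 ^ i * X 1 ^ j * X 2 ^ k)) =
      a * moment Λ (i + 2) j k + b * moment Λ i (j + 2) k + c * moment Λ i j (k + 2) +
      d * moment Λ (i + 1) (j + 1) k + e * moment Λ (i + 1) j (k + 1) +
      f * moment Λ i (j + 1) (k + 1) := by
  simp only [moment, ← smul_eq_mul (a := (_ : ℂ)), ← map_smul, ← map_add]
  congr 1
  simp only [conic, smul_eq_C_mul]
  ring

/-- The contraction of `Λ` by a conic can be computed on the six quadratic monomials. -/
lemma map_conic_mul {Λ : MvPolynomial (Fin 3) ℂ →ₗ[ℂ] ℂ} {a b c d e f : ℂ} (t : ℂ)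
    (l : Fin 3 → ℂ)
    (h : ∀ i j k, i + j + k = 2 → a * moment Λ (i + 2) j k + b * moment Λ i (j + 2) k +
      c * moment Λ i j (k + 2) + d * moment Λ (i + 1) (j + 1) k +
      e * moment Λ (i + 1) j (k + 1) + f * moment Λ i (j + 1) (k + 1) =
        t * (l 0 ^ i * l 1 ^ j * l 2 ^ k))
    {p : MvPolynomial (Fin 3) ℂ} (hp : p.IsHomogeneous 2) :
    Λ (conic a b c d e f * p) = t * eval l p := by
  have := hp.linearMap_eq_of_monomials (Λ₁ := Λ ∘ₗ LinearMap.mulLeft ℂ (conic a b c d e f))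
    (Λ₂ := t • evalLin l) (fun i j k hijk => by
      simpa [map_conic_mul_monomial] using h i j k hijk)
  simpa using this

lemma annihilates_conic {Λ : MvPolynomial (Fin 3) ℂ →ₗ[ℂ] ℂ} {a b c d e f : ℂ}
    (h : ∀ i j k, i + j + k = 2 → a * moment Λ (i + 2) j k + b * moment Λ i (j + 2) k +
      c * moment Λ i j (k + 2) + d * moment Λ (i + 1) (j + 1) k +
      e * moment Λ (i + 1) j (k + 1) + f * moment Λ i (j + 1) (k + 1) = 0) :
    Annihilates Λ (conic a b c d e f) := fun p hp => by
  simpa using map_conic_mul 0 0 (fun i j k hijk => by simpa using h i j k hijk) hp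

/-- The contraction of `Λ` by `X 2 ^ 2` is `c` times the evaluation at `(0, 0, 1)`. -/
def ContractsToPoint (c : ℂ) (Λ : MvPolynomial (Fin 3) ℂ →ₗ[ℂ] ℂ) : Prop :=
  ∀ p : MvPolynomial (Fin 3) ℂ, p.IsHomogeneous 2 → Λ (X 2 ^ 2 * p) = c * eval ![0, 0, 1] p

lemma ContractsToPoint.moment_eq {c : ℂ} {Λ : MvPolynomial (Fin 3) ℂ →ₗ[ℂ] ℂ}
    (h : ContractsToPoint c Λ) (i j k : ℕ) (hijk : i + j + k = 2) :
    moment Λ i j (k + 2) = c * (0 ^ i * 0 ^ j) := by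
  have := h _ (hijk ▸ isHomogeneous_monomial_three i j k)
  rw [moment, show (X 0 ^ i * X 1 ^ j * X 2 ^ (k + 2) : MvPolynomial (Fin 3) ℂ) =
    X 2 ^ 2 * (X 0 ^ i * X 1 ^ j * X 2 ^ k) by ring, this]
  simp

lemma ContractsToPoint.moments {c : ℂ} {Λ : MvPolynomial (Fin 3) ℂ →ₗ[ℂ] ℂ}
    (h : ContractsToPoint c Λ) : moment Λ 2 0 2 = 0 ∧ moment Λ 0 2 2 = 0 ∧ moment Λ 0 0 4 = c ∧
      moment Λ 1 1 2 = 0 ∧ moment Λ 1 0 3 = 0 ∧ moment Λ 0 1 3 = 0 := by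
  refine ⟨?_, ?_, ?_, ?_, ?_, ?_⟩
  · simpa using h.moment_eq 2 0 0 rfl
  · simpa using h.moment_eq 0 2 0 rfl
  · simpa using h.moment_eq 0 0 2 rfl
  · simpa using h.moment_eq 1 1 0 rfl
  · simpa using h.moment_eq 1 0 1 rfl
  · simpa using h.moment_eq 0 1 1 rfl

/-- The case where the cubic `Λ (X 2 * ·)` in `X 0, X 1` is apolar to `X 0 * X 1`. -/
lemma ContractsToPoint.hasNodes_eight_of_apolar_mul {c : ℂ}
    {Λ : MvPolynomial (Fin 3) ℂ →ₗ[ℂ] ℂ} (h : ContractsToPoint c Λ)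
    (hc : c = 0 ∨ Nondegenerate Λ) (h1 : moment Λ 2 1 1 = 0) (h2 : moment Λ 1 2 1 = 0) :
    HasNodes 8 Λ := by
  obtain ⟨z1, z2, z3, z4, z5, z6⟩ := h.moments
  by_cases hg0 : moment Λ 3 0 1 = 0
  · refine hasNodes_eight_of_not_isLinearSquare (isHomogeneous_conic 0 0 0 0 1 0)
      (not_isLinearSquare ![1, 0, 0] ![0, 0, 1] (by simp [eval_conic])) (annihilates_conic ?_)
    intro i j k hijk
    rcases eq_of_add_eq_two hijk with h | h | h | h | h | h <;> obtain ⟨rfl, rfl, rfl⟩ := h <;>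
      simp [*]
  by_cases hg3 : moment Λ 0 3 1 = 0
  · refine hasNodes_eight_of_not_isLinearSquare (isHomogeneous_conic 0 0 0 0 0 1)
      (not_isLinearSquare ![0, 1, 0] ![0, 0, 1] (by simp [eval_conic])) (annihilates_conic ?_)
    intro i j k hijk
    rcases eq_of_add_eq_two hijk with h | h | h | h | h | h <;> obtain ⟨rfl, rfl, rfl⟩ := h <;>
      simp [*]
  by_cases hd : moment Λ 2 2 0 = 0
  · refine hasNodes_eight_of_not_isLinearSquare (isHomogeneous_conic 0 0 0 1
      (-moment Λ 3 1 0 / moment Λ 3 0 1) (-moment Λ 1 3 0 / moment Λ 0 3 1))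
      (not_isLinearSquare ![1, 0, 0] ![0, 1, 0] (by simp [eval_conic])) (annihilates_conic ?_)
    intro i j k hijk
    rcases eq_of_add_eq_two hijk with h | h | h | h | h | h <;> obtain ⟨rfl, rfl, rfl⟩ := h <;>
      simp [*]
  set κ := (moment Λ 2 2 0)⁻¹ with hκ
  have hκ0 : κ ≠ 0 := inv_ne_zero hd
  have hκd : κ * moment Λ 2 2 0 = 1 := inv_mul_cancel₀ hd
  set b₁ := (1 - κ * moment Λ 3 1 0) / moment Λ 3 0 1 with hb₁
  set b₂ := (1 - κ * moment Λ 1 3 0) / moment Λ 0 3 1 with hb₂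
  have e₁ : b₁ * moment Λ 3 0 1 = 1 - κ * moment Λ 3 1 0 := div_mul_cancel₀ _ hg0
  have e₂ : b₂ * moment Λ 0 3 1 = 1 - κ * moment Λ 1 3 0 := div_mul_cancel₀ _ hg3
  have key : ∀ s : ℂ, s * c = 0 → ∀ p : MvPolynomial (Fin 3) ℂ, p.IsHomogeneous 2 →
      Λ (conic 0 0 s κ b₁ b₂ * p) = eval ![1, 1, 0] p := by
    intro s hs p hp
    rw [← one_mul (eval _ p)]
    refine map_conic_mul 1 _ (fun i j k hijk => ?_) hp
    rcases eq_of_add_eq_two hijk with h | h | h | h | h | h <;> obtain ⟨rfl, rfl, rfl⟩ := h <;>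
      simp [*]
  rcases hc with rfl | hc
  · refine (hasNodes_seven_of_linSubst !![κ, 0, b₂; 0, 1, b₁ / κ; 0, 0, 1] ?_ ?_).of_sub_evalLin
      (a := (eval ![1, 1, 0] (conic 0 0 (b₁ * b₂ / κ) κ b₁ b₂))⁻¹) (v := ![1, 1, 0])
    · simpa [Matrix.det_fin_three] using hκ0
    · convert annihilates_sub_evalLin (key (b₁ * b₂ / κ) (by simp))
        (by simpa [eval_conic] using hκ0) using 1
      refine MvPolynomial.funext fun v => ?_
      simp [eval_conic, dotProduct, Fin.sum_univ_three]
      field_simp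
      ring
  · exact hc.hasNodes_eight (isHomogeneous_conic _ _ _ _ _ _)
      (not_isLinearSquare ![1, 0, 0] ![0, 1, 0] (by simpa [eval_conic] using hκ0))
      (key 0 (by simp)) (by simpa [eval_conic] using hκ0)

/-- The case where the cubic `Λ (X 2 * ·)` in `X 0, X 1` is apolar to `X 0 ^ 2`. -/
lemma ContractsToPoint.hasNodes_eight_of_apolar_sq {c : ℂ}
    {Λ : MvPolynomial (Fin 3) ℂ →ₗ[ℂ] ℂ} (h : ContractsToPoint c Λ)
    (hc : c = 0 ∨ Nondegenerate Λ) (h0 : moment Λ 3 0 1 = 0) (h1 : moment Λ 2 1 1 = 0) :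
    HasNodes 8 Λ := by
  obtain ⟨z1, z2, z3, z4, z5, z6⟩ := h.moments
  by_cases hg : moment Λ 1 2 1 = 0
  · refine hasNodes_eight_of_not_isLinearSquare (isHomogeneous_conic 0 0 0 0 1 0)
      (not_isLinearSquare ![1, 0, 0] ![0, 0, 1] (by simp [eval_conic])) (annihilates_conic ?_)
    intro i j k hijk
    rcases eq_of_add_eq_two hijk with h | h | h | h | h | h <;> obtain ⟨rfl, rfl, rfl⟩ := h <;>
      simp [*]
  -- solve the equations of the contraction for the coefficients of the conic
  have key : ∀ κ t s b₂ : ℂ, ∀ l : ℂ, s * c = 0 → κ * moment Λ 4 0 0 = t →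
      κ * moment Λ 3 1 0 + b₂ * moment Λ 1 2 1 = t * l →
      ∀ p : MvPolynomial (Fin 3) ℂ, p.IsHomogeneous 2 →
      Λ (conic κ 0 s 0 ((t * l ^ 2 - κ * moment Λ 2 2 0 - b₂ * moment Λ 0 3 1) / moment Λ 1 2 1)
        b₂ * p) = t * eval ![1, l, 0] p := by
    intro κ t s b₂ l hs e₁ e₂ p hp
    have e₃ := div_mul_cancel₀ (t * l ^ 2 - κ * moment Λ 2 2 0 - b₂ * moment Λ 0 3 1) hg
    refine map_conic_mul t _ (fun i j k hijk => ?_) hp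
    rcases eq_of_add_eq_two hijk with h | h | h | h | h | h <;> obtain ⟨rfl, rfl, rfl⟩ := h <;>
      simp [*]
    ring
  by_cases hd : moment Λ 4 0 0 = 0
  · set b₂ := -moment Λ 3 1 0 / moment Λ 1 2 1 with hb₂
    have e₂ : b₂ * moment Λ 1 2 1 = -moment Λ 3 1 0 := div_mul_cancel₀ _ hg
    rcases hc with rfl | hc
    · set e := (0 * 0 ^ 2 - 1 * moment Λ 2 2 0 - b₂ * moment Λ 0 3 1) / moment Λ 1 2 1 with he
      refine hasNodes_eight_of_not_isLinearSquare
        (isHomogeneous_conic 1 0 (e ^ 2 / 4 + 1) 0 e b₂)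
        (not_isLinearSquare ![1, 0, 0] ![0, 0, 1] fun hsq => ?_) fun p hp => ?_
      · simp [eval_conic] at hsq
        grind
      · rw [key 1 0 (e ^ 2 / 4 + 1) b₂ 0 (by simp) (by simp [hd]) (by simp [e₂]) p hp, zero_mul]
    · have := hc _ (isHomogeneous_conic 1 0 0 0 _ b₂) fun p hp => by
        rw [key 1 0 0 b₂ 0 (by simp) (by simp [hd]) (by simp [e₂]) p hp, zero_mul]
      have := congrArg (eval ![1, 0, 0]) this
      simp [eval_conic] at this
  set κ := (moment Λ 4 0 0)⁻¹ with hκ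
  have hκ0 : κ ≠ 0 := inv_ne_zero hd
  have hκd : κ * moment Λ 4 0 0 = 1 := inv_mul_cancel₀ hd
  rcases hc with rfl | hc
  · set l := κ * moment Λ 3 1 0 with hl
    set e := (1 * l ^ 2 - κ * moment Λ 2 2 0 - 0 * moment Λ 0 3 1) / moment Λ 1 2 1 with he
    set m := e / (2 * κ) with hm
    have hem : e = 2 * κ * m := by rw [hm]; field_simp
    refine (hasNodes_seven_of_linSubst !![κ, 0, κ * (m + 1); 1, 0, m - 1; 0, 1, 0]
      ?_ ?_).of_sub_evalLin
      (a := (eval ![1, l, 0] (conic κ 0 (κ * (m ^ 2 - 1)) 0 e 0))⁻¹) (v := ![1, l, 0])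
    · simp [Matrix.det_fin_three]
      grind
    · convert annihilates_sub_evalLin (l := ![1, l, 0]) (q := conic κ 0 (κ * (m ^ 2 - 1)) 0 e 0)
        (fun p hp => ?_) (by simpa [eval_conic] using hκ0) using 1
      · refine MvPolynomial.funext fun v => ?_
        simp [eval_conic, dotProduct, Fin.sum_univ_three]
        rw [hem]
        ring
      · rw [key κ 1 _ 0 l (by simp) hκd (by simp [hl]) p hp, one_mul]
  · exact hc.hasNodes_eight (isHomogeneous_conic _ _ _ _ _ _)
      (not_isLinearSquare ![0, 1, 0] ![0, 0, 1] (by simp [eval_conic]))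
      (fun p hp => (key κ 1 0 1 (κ * moment Λ 3 1 0 + moment Λ 1 2 1) (by simp) hκd
        (by simp) p hp).trans (one_mul _)) (by simpa [eval_conic] using hκ0)

/-- A binary quadratic form over `ℂ` is a product of linear forms. -/
lemma exists_factor_binary_quadratic (h : Fin 3 → ℂ) :
    ∃ a₁ a₂ b₁ b₂ : ℂ, h 0 = a₁ * b₁ ∧ h 1 = a₁ * b₂ + a₂ * b₁ ∧ h 2 = a₂ * b₂ := by
  rcases eq_or_ne (h 0) 0 with h0 | h0
  · exact ⟨0, 1, h 1, h 2, by simp [h0], by simp, by simp⟩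
  · obtain ⟨s, hs⟩ := IsAlgClosed.exists_pow_nat_eq (h 1 ^ 2 - 4 * h 0 * h 2) (n := 2) (by norm_num)
    refine ⟨1, (h 1 - s) / (2 * h 0), h 0, (h 1 + s) / 2, by ring, by field_simp; ring, ?_⟩
    field_simp
    linear_combination hs

lemma ContractsToPoint.changeCoords {c : ℂ} {Λ : MvPolynomial (Fin 3) ℂ →ₗ[ℂ] ℂ}
    (h : ContractsToPoint c Λ) (a₁ a₂ b₁ b₂ : ℂ) :
    ContractsToPoint c (changeCoords !![a₁, a₂, 0; b₁, b₂, 0; 0, 0, 1] Λ) := by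
  intro p hp
  have h2 : linSubst !![a₁, a₂, 0; b₁, b₂, 0; 0, 0, 1] (X 2 ^ 2) = X 2 ^ 2 := by
    simp [linSubst, Fin.sum_univ_three]
  rw [changeCoords_apply, map_mul, h2, h _ (hp.linSubst _), eval_linSubst]
  congr 3
  ext i
  fin_cases i <;> simp

lemma ContractsToPoint.hasNodes_eight {c : ℂ} {Λ : MvPolynomial (Fin 3) ℂ →ₗ[ℂ] ℂ}
    (h : ContractsToPoint c Λ) (hc : c = 0 ∨ Nondegenerate Λ) : HasNodes 8 Λ := by
  obtain ⟨v, hv, hv0⟩ := Matrix.exists_mulVec_eq_zero_iff.2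
    (show (!![moment Λ 3 0 1, moment Λ 2 1 1, moment Λ 1 2 1;
      moment Λ 2 1 1, moment Λ 1 2 1, moment Λ 0 3 1; 0, 0, 0]).det = 0 by
        simp [Matrix.det_fin_three])
  have v0 := congrFun hv0 0
  have v1 := congrFun hv0 1
  simp [dotProduct, Fin.sum_univ_three] at v0 v1
  obtain ⟨a₁, a₂, b₁, b₂, e0, e1, e2⟩ := exists_factor_binary_quadratic v
  have key : ∀ s t : ℂ, Λ ((C a₁ * X 0 + C a₂ * X 1) * (C b₁ * X 0 + C b₂ * X 1) *
      (C s * X 0 + C t * X 1) * X 2) = 0 := by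
    intro s t
    have : (C a₁ * X 0 + C a₂ * X 1) * (C b₁ * X 0 + C b₂ * X 1) *
        (C s * X 0 + C t * X 1) * X 2 =
        (s * v 0) • (X 0 ^ 3 * X 1 ^ 0 * X 2 ^ 1 : MvPolynomial (Fin 3) ℂ) +
        (s * v 1 + t * v 0) • (X 0 ^ 2 * X 1 ^ 1 * X 2 ^ 1) +
        (s * v 2 + t * v 1) • (X 0 ^ 1 * X 1 ^ 2 * X 2 ^ 1) +
        (t * v 2) • (X 0 ^ 0 * X 1 ^ 3 * X 2 ^ 1) := by
      simp only [e0, e1, e2, smul_eq_C_mul, map_add, map_mul]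
      ring
    rw [this]
    simp only [moment] at v0 v1
    simp only [map_add, map_smul, smul_eq_mul]
    linear_combination s * v0 + t * v1
  by_cases hdet : a₁ * b₂ - a₂ * b₁ = 0
  · obtain ⟨p, r, s, hpr, hb₁, hb₂⟩ : ∃ p r s : ℂ, a₁ * r - a₂ * p ≠ 0 ∧ b₁ = s * a₁ ∧
        b₂ = s * a₂ := by
      by_cases ha₁ : a₁ = 0
      · have ha₂ : a₂ ≠ 0 := by
          rintro rfl
          refine hv (funext fun i => ?_)
          fin_cases i <;> simp [e0, e1, e2, ha₁]
        exact ⟨1, 0, b₂ / a₂, by simpa using ha₂, by grind, by field_simp⟩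
      · exact ⟨0, 1, b₁ / a₁, by simpa using ha₁, by field_simp, by grind⟩
    have hs : s ≠ 0 := by
      rintro rfl
      refine hv (funext fun i => ?_)
      fin_cases i <;> simp [e0, e1, e2, hb₁, hb₂]
    have key' : ∀ p r : ℂ,
        Λ ((C a₁ * X 0 + C a₂ * X 1) ^ 2 * (C p * X 0 + C r * X 1) * X 2) = 0 := by
      intro p r
      have := key p r
      rw [hb₁, hb₂, show (C a₁ * X 0 + C a₂ * X 1) * (C (s * a₁) * X 0 + C (s * a₂) * X 1) *
        (C p * X 0 + C r * X 1) * X 2 = s • ((C a₁ * X 0 + C a₂ * X 1) ^ 2 *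
          (C p * X 0 + C r * X 1) * X 2 : MvPolynomial (Fin 3) ℂ) by
            simp only [map_mul, smul_eq_C_mul]; ring, map_smul, smul_eq_zero] at this
      exact this.resolve_left hs
    have hM : (!![a₁, a₂, 0; p, r, 0; 0, 0, 1]).det ≠ 0 := by
      simpa [Matrix.det_fin_three] using hpr
    refine ((h.changeCoords a₁ a₂ p r).hasNodes_eight_of_apolar_sq
      (hc.imp_right fun hc => hc.changeCoords hM) ?_ ?_).of_changeCoords hM
    · convert key' a₁ a₂ using 1
      simp [moment, linSubst, Fin.sum_univ_three]
      ring_nf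
    · convert key' p r using 1
      simp [moment, linSubst, Fin.sum_univ_three]
  · have hM : (!![a₁, a₂, 0; b₁, b₂, 0; 0, 0, 1]).det ≠ 0 := by
      simpa [Matrix.det_fin_three] using hdet
    refine ((h.changeCoords a₁ a₂ b₁ b₂).hasNodes_eight_of_apolar_mul
      (hc.imp_right fun hc => hc.changeCoords hM) ?_ ?_).of_changeCoords hM
    · convert key a₁ a₂ using 1
      simp [moment, linSubst, Fin.sum_univ_three]
      ring_nf
    · convert key b₁ b₂ using 1
      simp [moment, linSubst, Fin.sum_univ_three]
      ring_nf

/-- For nondegenerate `Λ` some point evaluation on quadratic forms is the contraction of `Λ` by a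
quadratic form not vanishing at that point. -/
lemma Nondegenerate.exists_contraction {Λ : MvPolynomial (Fin 3) ℂ →ₗ[ℂ] ℂ}
    (hΛ : Nondegenerate Λ) : ∃ (q : MvPolynomial (Fin 3) ℂ) (l : Fin 3 → ℂ), q.IsHomogeneous 2 ∧
      (∀ p : MvPolynomial (Fin 3) ℂ, p.IsHomogeneous 2 → Λ (q * p) = eval l p) ∧
      eval l q ≠ 0 := by
  let W := homogeneousSubmodule (Fin 3) ℂ 2
  have : Module.Finite ℂ W := Module.Finite.iff_fg.2 (homogeneousSubmodule_fg _ ℂ 2)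
  let B : W →ₗ[ℂ] Module.Dual ℂ W :=
    ((LinearMap.mul ℂ (MvPolynomial (Fin 3) ℂ)).compr₂ Λ).domRestrict₁₂ W W
  have hB : ∀ r p : W, B r p = Λ (r * p) := fun r p => rfl
  have hinj : Function.Injective B := by
    rw [injective_iff_map_eq_zero]
    intro r hr
    refine Subtype.ext (hΛ r r.2 fun p hp => ?_)
    rw [← hB r ⟨p, hp⟩, hr, LinearMap.zero_apply]
  have hsurj : Function.Surjective B :=
    (LinearMap.injective_iff_surjective_of_finrank_eq_finrank Subspace.dual_finrank_eq.symm).1 hinj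
  have : Nontrivial W := ⟨⟨⟨X 0 ^ 2, isHomogeneous_X_pow 0 2⟩, 0, fun h => by
    simpa using congrArg Subtype.val h⟩⟩
  let e := Module.finBasis ℂ W
  choose f hf using fun i => hsurj (e.coord i)
  have hfe : ∀ i j, Λ ((f i : MvPolynomial (Fin 3) ℂ) * e j) = if i = j then 1 else 0 := by
    intro i j
    rw [← hB, hf, Module.Basis.coord_apply, Module.Basis.repr_self, Finsupp.single_apply]
    simp [eq_comm]
  have hne : (∑ i, (f i : MvPolynomial (Fin 3) ℂ) * e i) ≠ 0 := by
    intro h0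
    have := congrArg Λ h0
    simp only [map_sum, hfe, map_zero, if_true, Finset.sum_const, Finset.card_univ,
      Fintype.card_fin, nsmul_eq_mul, mul_one, Nat.cast_eq_zero] at this
    exact Module.finrank_pos.ne' this
  obtain ⟨l, hl⟩ : ∃ l, eval l (∑ i, (f i : MvPolynomial (Fin 3) ℂ) *
      (e i : MvPolynomial (Fin 3) ℂ)) ≠ 0 := by
    by_contra! hcon
    exact hne (MvPolynomial.funext fun v => by rw [hcon, map_zero])
  let q : W := ∑ i, eval l (e i : MvPolynomial (Fin 3) ℂ) • f i
  refine ⟨q, l, q.2, ?_, ?_⟩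
  · intro p hp
    have : B q = evalLin l ∘ₗ W.subtype := by
      refine e.ext fun j => ?_
      rw [hB]
      simp [q, Finset.sum_mul, hfe]
    simpa [hB] using LinearMap.congr_fun this ⟨p, hp⟩
  · convert hl using 1
    simp [q, mul_comm, smul_eval]

/-- Coordinates in which a linear form becomes `X 2` and a point off the corresponding line becomes
a multiple of `(0, 0, 1)`. -/
lemma exists_coordinates {n l : Fin 3 → ℂ} (hnl : ∑ i, n i * l i ≠ 0) :
    ∃ M : Matrix (Fin 3) (Fin 3) ℂ, M.det ≠ 0 ∧ M 2 = n ∧ ∃ t : ℂ, M.mulVec l = ![0, 0, t] := by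
  rw [Fin.sum_univ_three] at hnl
  by_cases h0 : l 0 = 0
  · by_cases h1 : l 1 = 0
    · have h2 : l 2 ≠ 0 := by rintro h2; simp [*] at hnl
      refine ⟨!![1, 0, 0; 0, 1, 0; n 0, n 1, n 2], ?_, ?_, n 2 * l 2, ?_⟩
      · simp [Matrix.det_fin_three]; rintro h; simp [*] at hnl
      · ext i; fin_cases i <;> simp
      · ext i; fin_cases i <;> simp [dotProduct, Fin.sum_univ_three, h0, h1]
    · refine ⟨!![1, 0, 0; 0, l 2, -l 1; n 0, n 1, n 2], ?_, ?_, n 1 * l 1 + n 2 * l 2, ?_⟩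
      · simp [Matrix.det_fin_three]; grind
      · ext i; fin_cases i <;> simp
      · ext i; fin_cases i <;> simp [dotProduct, Fin.sum_univ_three, h0]; ring
  · refine ⟨!![l 1, -l 0, 0; l 2, 0, -l 0; n 0, n 1, n 2], ?_, ?_,
      n 0 * l 0 + n 1 * l 1 + n 2 * l 2, ?_⟩
    · simp [Matrix.det_fin_three]; grind
    · ext i; fin_cases i <;> simp
    · ext i; fin_cases i <;> simp [dotProduct, Fin.sum_univ_three] <;> ring

lemma hasNodes_eight (Λ : MvPolynomial (Fin 3) ℂ →ₗ[ℂ] ℂ) : HasNodes 8 Λ := by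
  by_cases hΛ : Nondegenerate Λ
  · obtain ⟨q, l, hq, hql, hl⟩ := hΛ.exists_contraction
    by_cases hsq : IsLinearSquare q
    · obtain ⟨n, rfl⟩ := hsq
      obtain ⟨M, hM, hMn, t, ht⟩ := exists_coordinates (n := n) (l := l) fun h => hl (by simp [h])
      have hcontr : ContractsToPoint (t ^ 2) (changeCoords M Λ) := by
        intro p hp
        rw [changeCoords_apply, map_mul, linSubst_X_two_sq, hMn, hql _ (hp.linSubst M),
          eval_linSubst, ht]
        have := hp.linearMap_eq_of_monomials (Λ₁ := evalLin ![0, 0, t])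
          (Λ₂ := t ^ 2 • evalLin ![0, 0, 1]) fun i j k hijk => by
            rcases eq_of_add_eq_two hijk with h | h | h | h | h | h <;>
              obtain ⟨rfl, rfl, rfl⟩ := h <;> simp
        simpa using this
      exact (hcontr.hasNodes_eight (Or.inr (hΛ.changeCoords hM))).of_changeCoords hM
    · exact hΛ.hasNodes_eight hq hsq hql hl
  · simp only [Nondegenerate, not_forall] at hΛ
    obtain ⟨r, hr, hann, hr0⟩ := hΛ
    obtain ⟨M, hM, h⟩ := exists_conic_normal_form hr
    rcases h with rfl | rfl | rfl | rfl
    · exact (hasNodes_eight_of_smooth_conic hann.changeCoords).of_changeCoords hM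
    · exact (hasNodes_seven_of_linSubst M hM hann).mono (by norm_num)
    · have hcontr : ContractsToPoint 0 (changeCoords M Λ) := fun p hp => by
        rw [hann.changeCoords p hp, zero_mul]
      exact (hcontr.hasNodes_eight (Or.inl rfl)).of_changeCoords hM
    · exact (hr0 rfl).elim

/-- The functional dual to a quartic form: it sends the fourth power of a linear form to the
value of the quartic at the coefficients of the linear form. -/
lemma exists_dual_functional {f : MvPolynomial (Fin 3) ℂ} (hf : f.IsHomogeneous 4) :
    ∃ Λ : MvPolynomial (Fin 3) ℂ →ₗ[ℂ] ℂ, ∀ x : Fin 3 → ℂ,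
      Λ ((∑ i, x i • X i) ^ 4) = eval x f := by
  refine ⟨∑ m ∈ f.support, (coeff m f / m.multinomial) • lcoeff ℂ m, fun x => ?_⟩
  rw [LinearMap.sum_apply, eval_eq]
  refine Finset.sum_congr rfl fun m hm => ?_
  have hdeg : m.sum (fun _ k => k) = 4 := (hf.degree_eq_sum_deg_support hm).symm
  have hmul : (m.multinomial : ℂ) ≠ 0 := by
    exact_mod_cast (Nat.multinomial_pos _ _).ne'
  rw [LinearMap.smul_apply, lcoeff_apply, coeff_linearCombination_X_pow_of_fintype, if_pos hdeg,
    smul_eq_mul, Finsupp.prod]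
  field_simp

/-- Every ternary quartic form over `ℂ` is a sum of at most `8` fourth powers of linear
forms. -/
theorem ternary_quartic_sum_eight_fourth_powers (f : MvPolynomial (Fin 3) ℂ)
    (hf : f.IsHomogeneous 4) :
    ∃ l₁ l₂ l₃ l₄ l₅ l₆ l₇ l₈ : MvPolynomial (Fin 3) ℂ,
      l₁.IsHomogeneous 1 ∧ l₂.IsHomogeneous 1 ∧ l₃.IsHomogeneous 1 ∧
      l₄.IsHomogeneous 1 ∧ l₅.IsHomogeneous 1 ∧ l₆.IsHomogeneous 1 ∧
      l₇.IsHomogeneous 1 ∧ l₈.IsHomogeneous 1 ∧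
      f = l₁ ^ 4 + l₂ ^ 4 + l₃ ^ 4 + l₄ ^ 4 + l₅ ^ 4 + l₆ ^ 4 + l₇ ^ 4 + l₈ ^ 4 := by
  obtain ⟨Λ, hΛ⟩ := exists_dual_functional hf
  obtain ⟨w, v, h⟩ := hasNodes_eight Λ
  choose ρ hρ using fun i => IsAlgClosed.exists_pow_nat_eq (w i) (n := 4) (by norm_num)
  let l : Fin 8 → MvPolynomial (Fin 3) ℂ := fun i => ∑ j, C (ρ i * v i j) * X j
  have hl : ∀ i, (l i).IsHomogeneous 1 := fun i =>
    IsHomogeneous.sum _ _ _ fun j _ => isHomogeneous_C_mul_X _ _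
  refine ⟨l 0, l 1, l 2, l 3, l 4, l 5, l 6, l 7, hl 0, hl 1, hl 2, hl 3, hl 4, hl 5, hl 6, hl 7,
    ?_⟩
  rw [← Fin.sum_univ_eight fun i => l i ^ 4]
  refine MvPolynomial.funext fun x => ?_
  have hx : ((∑ i, x i • X i : MvPolynomial (Fin 3) ℂ) ^ 4).IsHomogeneous 4 := by
    have h1 : (∑ i, x i • X i : MvPolynomial (Fin 3) ℂ).IsHomogeneous 1 :=
      IsHomogeneous.sum _ _ _ fun j _ => by
        simpa [smul_eq_C_mul] using isHomogeneous_C_mul_X (x j) j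
    simpa using h1.pow 4
  rw [← hΛ, h _ hx, map_sum]
  refine Finset.sum_congr rfl fun i _ => ?_
  simp only [← hρ, l, Fin.sum_univ_three, map_pow, map_add, map_mul, eval_C, eval_X, smul_eval]
  ring
end

section
/- Every tensor in ℂ³ ⊗ ℂ³ ⊗ ℂ³ is a sum of at most 6 simple (decomposable) tensors: for every T ∈ (Fin 3 → ℂ) ⊗[ℂ] (Fin 3 → ℂ) ⊗[ℂ] (Fin 3 → ℂ) there exist u, v, w : Fin 6 → (Fin 3 → ℂ) such that T = ∑_{i : Fin 6} (u i) ⊗ₜ (v i) ⊗ₜ (w i). -/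
open TensorProduct

open Matrix

namespace Matrix

variable {n : Type*} [Fintype n] [DecidableEq n]

theorem isRoot_charpoly_iff_det (A : Matrix n n ℂ) (μ : ℂ) :
    A.charpoly.IsRoot μ ↔ (A - μ • 1).det = 0 := by
  rw [Polynomial.IsRoot, eval_charpoly, ← neg_sub, det_neg, smul_one_eq_diagonal, scalar_apply]
  simp

theorem exists_det_sub_smul_one_eq_zero [Nonempty n] (A : Matrix n n ℂ) :
    ∃ μ : ℂ, (A - μ • 1).det = 0 := by
  obtain ⟨μ, hμ⟩ := IsAlgClosed.exists_root A.charpoly (by simp [charpoly_degree_eq_dim])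
  exact ⟨μ, (A.isRoot_charpoly_iff_det μ).1 hμ⟩

/-- A complex matrix with a single eigenvalue is nilpotent up to a scalar matrix. -/
theorem sub_smul_one_pow_card_eq_zero {A : Matrix n n ℂ} {ν : ℂ}
    (h : ∀ μ : ℂ, (A - μ • 1).det = 0 → μ = ν) : (A - ν • 1) ^ Fintype.card n = 0 := by
  have hsplits := IsAlgClosed.splits A.charpoly
  have hroots : A.charpoly.roots = Multiset.replicate (Fintype.card n) ν := by
    refine Multiset.eq_replicate.2 ⟨?_, fun μ hμ => ?_⟩
    · rw [← hsplits.natDegree_eq_card_roots, charpoly_natDegree_eq_dim]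
    · exact h μ ((A.isRoot_charpoly_iff_det μ).1 (Polynomial.isRoot_of_mem_roots hμ))
  have hA := aeval_self_charpoly A
  rw [hsplits.eq_prod_roots_of_monic A.charpoly_monic, hroots] at hA
  simpa [Algebra.algebraMap_eq_smul_one] using hA

end Matrix

/-- The subspace `S` of matrices lies in the span of `r` matrices of rank at most one. -/
def SpannedByRankOnes {m n : Type*} (r : ℕ) (S : Submodule ℂ (Matrix m n ℂ)) : Prop :=
  ∃ (v : Fin r → m → ℂ) (w : Fin r → n → ℂ),
    S ≤ Submodule.span ℂ (Set.range fun l => vecMulVec (v l) (w l))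

namespace SpannedByRankOnes

variable {m n : Type*} {r s : ℕ} {S S' : Submodule ℂ (Matrix m n ℂ)}

theorem mono (h : SpannedByRankOnes r S) (hS : S' ≤ S) : SpannedByRankOnes r S' :=
  let ⟨v, w, hvw⟩ := h
  ⟨v, w, hS.trans hvw⟩

theorem sup (h : SpannedByRankOnes r S) (h' : SpannedByRankOnes s S') :
    SpannedByRankOnes (r + s) (S ⊔ S') := by
  obtain ⟨v, w, h⟩ := h
  obtain ⟨v', w', h'⟩ := h'
  refine ⟨Fin.append v v', Fin.append w w', sup_le (h.trans ?_) (h'.trans ?_)⟩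
  · refine Submodule.span_mono ?_
    rintro _ ⟨l, rfl⟩
    exact ⟨Fin.castAdd s l, by simp⟩
  · refine Submodule.span_mono ?_
    rintro _ ⟨l, rfl⟩
    exact ⟨Fin.natAdd r l, by simp⟩

theorem mono_left (h : SpannedByRankOnes r S) (hrs : r ≤ s) : SpannedByRankOnes s S := by
  obtain ⟨k, rfl⟩ := Nat.exists_eq_add_of_le hrs
  have h0 : SpannedByRankOnes k (⊥ : Submodule ℂ (Matrix m n ℂ)) := ⟨0, 0, bot_le⟩
  simpa using h.sup h0

/-- Two-sided multiplication does not increase the number of rank-one matrices needed. -/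
theorem of_mul_mul [Fintype m] [Fintype n] {A : Set (Matrix m n ℂ)} (P : Matrix m m ℂ)
    (Q : Matrix n n ℂ) (h : SpannedByRankOnes r (Submodule.span ℂ A)) :
    SpannedByRankOnes r (Submodule.span ℂ ((fun M => P * M * Q) '' A)) := by
  obtain ⟨v, w, h⟩ := h
  refine ⟨fun l => P *ᵥ v l, fun l => w l ᵥ* Q, ?_⟩
  let f : Matrix m n ℂ →ₗ[ℂ] Matrix m n ℂ := mulRightLinearMap m ℂ Q ∘ₗ mulLeftLinearMap n ℂ P
  have key := Submodule.map_mono (f := f) h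
  rw [Submodule.map_span, Submodule.map_span, ← Set.range_comp] at key
  convert key using 4
  · simp [f]
  · simp [f, mul_vecMulVec, vecMulVec_mul]

theorem of_rank_le [Fintype m] [Fintype n] [DecidableEq n] {M : Matrix m n ℂ} (hM : M.rank ≤ r) :
    SpannedByRankOnes r (Submodule.span ℂ {M}) := by
  refine mono_left ?_ hM
  let b : Module.Basis (Fin M.rank) ℂ (LinearMap.range M.mulVecLin) := Module.finBasis ℂ _
  let x (j : n) : LinearMap.range M.mulVecLin := ⟨M *ᵥ Pi.single j 1, ⟨_, rfl⟩⟩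
  refine ⟨fun l => b l, fun l j => b.repr (x j) l, ?_⟩
  have hsum : M = ∑ l, vecMulVec (b l : m → ℂ) (fun j => b.repr (x j) l) := by
    ext i j
    have := congrFun (congrArg Subtype.val (b.sum_repr (x j))) i
    simp only [x, mulVec_single_one, Submodule.coe_sum, Submodule.coe_smul, Finset.sum_apply,
      Pi.smul_apply, smul_eq_mul, col_apply] at this
    rw [← this, Matrix.sum_apply]
    simp [vecMulVec_apply, mul_comm, x]
  rw [Submodule.span_singleton_le_iff_mem]
  have hmem := Submodule.sum_mem _ fun l (_ : l ∈ Finset.univ) =>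
    Submodule.subset_span (R := ℂ) (Set.mem_range_self (f := fun l =>
      vecMulVec (b l : m → ℂ) (fun j => b.repr (x j) l)) l)
  rwa [← hsum] at hmem

theorem of_det_eq_zero {M : Matrix (Fin 3) (Fin 3) ℂ} (hM : M.det = 0) :
    SpannedByRankOnes 2 (Submodule.span ℂ {M}) := by
  refine of_rank_le ?_
  by_contra! h
  have h3 : M.rank = 3 := le_antisymm (by simpa using M.rank_le_card_width) h
  have : IsUnit M := by
    have htop : LinearMap.range M.mulVecLin = ⊤ :=
      Submodule.eq_top_of_finrank_eq (h3.trans (by simp))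
    exact mulVec_surjective_iff_isUnit.1 (LinearMap.range_eq_top.1 htop)
  exact ((isUnit_iff_isUnit_det M).1 this).ne_zero hM

theorem of_det_eq_zero_triple {A B C : Matrix (Fin 3) (Fin 3) ℂ} (hA : A.det = 0) (hB : B.det = 0)
    (hC : C.det = 0) : SpannedByRankOnes 6 (Submodule.span ℂ {A, B, C}) := by
  have := (of_det_eq_zero hA).sup ((of_det_eq_zero hB).sup (of_det_eq_zero hC))
  rwa [← Submodule.span_union, ← Submodule.span_union] at this

/-- The identity and a nilpotent Jordan block: a rank-one change of the block is diagonalizable. -/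
theorem one_shift :
    SpannedByRankOnes 4
      (Submodule.span ℂ {(1 : Matrix (Fin 3) (Fin 3) ℂ), !![0, 0, 0; 1, 0, 0; 0, 1, 0]}) := by
  let v : Fin 4 → Fin 3 → ℂ := ![![1, 0, -1], ![0, 1 / 2, 1 / 2], ![0, -1 / 2, 1 / 2], ![0, 1, 0]]
  let w : Fin 4 → Fin 3 → ℂ := ![![1, 0, 0], ![1, 1, 1], ![1, -1, 1], ![0, 0, 1]]
  refine ⟨v, w, ?_⟩
  rw [Submodule.span_le, Set.insert_subset_iff, Set.singleton_subset_iff]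
  refine ⟨(Submodule.mem_span_range_iff_exists_fun ℂ).2 ⟨![1, 1, 1, 0], ?_⟩,
    (Submodule.mem_span_range_iff_exists_fun ℂ).2 ⟨![0, 1, -1, -1], ?_⟩⟩ <;>
  · ext i j
    fin_cases i <;> fin_cases j <;>
      simp [Fin.sum_univ_succ, v, w] <;> norm_num

theorem one_of_pow_three_eq_zero {N : Matrix (Fin 3) (Fin 3) ℂ} (hN : N ^ 3 = 0) :
    SpannedByRankOnes 4 (Submodule.span ℂ {1, N}) := by
  by_cases h2 : N * N = 0
  · have hr : N.rank ≤ 1 := by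
      have := rank_add_rank_le_card_of_mul_eq_zero h2
      simp at this
      omega
    have h1 : (1 : Matrix (Fin 3) (Fin 3) ℂ).rank ≤ 3 := by simp
    have := (of_rank_le h1).sup (of_rank_le hr)
    rwa [← Submodule.span_union] at this
  obtain ⟨x, hx⟩ : ∃ x, (N * N) *ᵥ x ≠ 0 := by
    by_contra! h
    exact h2 (Matrix.ext_of_mulVec_single fun i => by rw [h, zero_mulVec])
  have hNx : N *ᵥ (N *ᵥ x) = (N * N) *ᵥ x := mulVec_mulVec _ _ _
  have h3 : N *ᵥ ((N * N) *ᵥ x) = 0 := by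
    rw [mulVec_mulVec, ← mul_assoc, ← pow_three', hN, zero_mulVec]
  let P : Matrix (Fin 3) (Fin 3) ℂ := (Matrix.of ![x, N *ᵥ x, (N * N) *ᵥ x])ᵀ
  have hP (c : Fin 3 → ℂ) :
      P *ᵥ c = c 0 • x + c 1 • (N *ᵥ x) + c 2 • ((N * N) *ᵥ x) := by
    ext i
    simp [P, mulVec, dotProduct, Fin.sum_univ_three, mul_comm]
  have hdet : IsUnit P.det := by
    rw [isUnit_iff_ne_zero]
    intro h
    obtain ⟨c, hc, hPc⟩ := exists_mulVec_eq_zero_iff.2 h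
    rw [hP] at hPc
    have e1 := congrArg (N *ᵥ ·) hPc
    simp only [mulVec_add, mulVec_smul, hNx, h3, smul_zero, add_zero, mulVec_zero] at e1
    have e2 := congrArg (N *ᵥ ·) e1
    simp only [mulVec_add, mulVec_smul, hNx, h3, smul_zero, add_zero, mulVec_zero] at e2
    have c0 : c 0 = 0 := (smul_eq_zero.1 e2).resolve_right hx
    have c1 : c 1 = 0 := by simpa [c0, hx] using e1
    have c2 : c 2 = 0 := by simpa [c0, c1, hx] using hPc
    exact hc (funext fun i => by fin_cases i <;> assumption)
  have hNP : N * P = P * !![0, 0, 0; 1, 0, 0; 0, 1, 0] := by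
    refine Matrix.ext_of_mulVec_single fun i => ?_
    rw [← mulVec_mulVec, ← mulVec_mulVec, hP, hP]
    fin_cases i <;> simp [hNx, h3]
  convert one_shift.of_mul_mul P P⁻¹ using 2
  rw [Set.image_pair, ← hNP, mul_one, mul_nonsing_inv_cancel_right _ _ hdet, mul_nonsing_inv _ hdet]

theorem one_pair (M N : Matrix (Fin 3) (Fin 3) ℂ) :
    SpannedByRankOnes 6 (Submodule.span ℂ {1, M, N}) := by
  obtain ⟨μ, hμ⟩ := exists_det_sub_smul_one_eq_zero M
  obtain ⟨ν, hν⟩ := exists_det_sub_smul_one_eq_zero N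
  have span_le {S : Submodule ℂ (Matrix (Fin 3) (Fin 3) ℂ)} (h1 : 1 ∈ S) (hM : M - μ • 1 ∈ S)
      (hN : N - ν • 1 ∈ S) : Submodule.span ℂ {1, M, N} ≤ S := by
    rw [Submodule.span_le, Set.insert_subset_iff, Set.pair_subset_iff]
    exact ⟨h1, by simpa using add_mem hM (S.smul_mem μ h1),
      by simpa using add_mem hN (S.smul_mem ν h1)⟩
  by_cases h : ∃ ν', ν' ≠ ν ∧ (N - ν' • 1).det = 0
  · obtain ⟨ν', hne, hν'⟩ := h
    refine (of_det_eq_zero_triple hμ hν hν').mono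
      (span_le ?_ (Submodule.subset_span (by simp)) (Submodule.subset_span (by simp)))
    rw [Submodule.mem_span_triple]
    refine ⟨0, (ν' - ν)⁻¹, -(ν' - ν)⁻¹, ?_⟩
    rw [zero_smul, zero_add, neg_smul, ← sub_eq_add_neg, ← smul_sub, sub_sub_sub_cancel_left,
      ← sub_smul, smul_smul, inv_mul_cancel₀ (sub_ne_zero.2 hne), one_smul]
  · push Not at h
    have hnil : (N - ν • 1) ^ 3 = 0 := by
      simpa using sub_smul_one_pow_card_eq_zero fun ν' hν' => by_contra fun hne => h ν' hne hν'
    refine ((of_det_eq_zero hμ).sup (one_of_pow_three_eq_zero hnil)).mono ?_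
    rw [← Submodule.span_union]
    exact span_le (Submodule.subset_span (by simp)) (Submodule.subset_span (by simp))
      (Submodule.subset_span (by simp))

theorem of_det_ne_zero {A : Matrix (Fin 3) (Fin 3) ℂ} (hA : A.det ≠ 0)
    (B C : Matrix (Fin 3) (Fin 3) ℂ) : SpannedByRankOnes 6 (Submodule.span ℂ {A, B, C}) := by
  have hu : IsUnit A.det := hA.isUnit
  convert (one_pair (A⁻¹ * B) (A⁻¹ * C)).of_mul_mul A 1 using 2
  simp [Set.image_insert_eq, mul_nonsing_inv_cancel_left _ _ hu]

end SpannedByRankOnes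

theorem spannedByRankOnes_six (A B C : Matrix (Fin 3) (Fin 3) ℂ) :
    SpannedByRankOnes 6 (Submodule.span ℂ {A, B, C}) := by
  by_cases hA : A.det = 0
  · by_cases hB : B.det = 0
    · by_cases hC : C.det = 0
      · exact .of_det_eq_zero_triple hA hB hC
      · convert SpannedByRankOnes.of_det_ne_zero hC A B using 2
        grind
    · convert SpannedByRankOnes.of_det_ne_zero hB A C using 2
      grind
  · exact .of_det_ne_zero hA B C

/-- The tensor in `ℂᵐ ⊗ ℂⁿ` with a given coordinate matrix. -/
noncomputable def tensorOfMatrix {m n : Type*} [Fintype m] [Fintype n] [DecidableEq m]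
    [DecidableEq n] : Matrix m n ℂ →ₗ[ℂ] (m → ℂ) ⊗[ℂ] (n → ℂ) :=
  ∑ i, ∑ j, (entryLinearMap ℂ ℂ i j).smulRight (Pi.single i 1 ⊗ₜ[ℂ] Pi.single j 1)

theorem tensorOfMatrix_vecMulVec {m n : Type*} [Fintype m] [Fintype n] [DecidableEq m]
    [DecidableEq n] (a : m → ℂ) (b : n → ℂ) : tensorOfMatrix (vecMulVec a b) = a ⊗ₜ[ℂ] b := by
  conv_rhs => rw [pi_eq_sum_univ' a, pi_eq_sum_univ' b]
  simp only [tensorOfMatrix, sum_tmul, tmul_sum, smul_tmul_smul, LinearMap.sum_apply,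
    LinearMap.smulRight_apply, entryLinearMap_apply, vecMulVec_apply]
  exact Finset.sum_comm

theorem tensorOfMatrix_surjective {m n : Type*} [Fintype m] [Fintype n] [DecidableEq m]
    [DecidableEq n] : Function.Surjective (tensorOfMatrix (m := m) (n := n)) := by
  intro t
  induction t with
  | zero => exact ⟨0, map_zero _⟩
  | tmul a b => exact ⟨_, tensorOfMatrix_vecMulVec a b⟩
  | add s t hs ht =>
    obtain ⟨A, rfl⟩ := hs
    obtain ⟨B, rfl⟩ := ht
    exact ⟨A + B, map_add _ _ _⟩

theorem exists_eq_sum_single_tmul {m V : Type*} [Fintype m] [DecidableEq m] [AddCommGroup V]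
    [Module ℂ V] (T : (m → ℂ) ⊗[ℂ] V) :
    ∃ t : m → V, T = ∑ i, Pi.single i (1 : ℂ) ⊗ₜ[ℂ] t i := by
  induction T with
  | zero => exact ⟨0, by simp⟩
  | tmul a x =>
    refine ⟨fun i => a i • x, ?_⟩
    conv_lhs => rw [pi_eq_sum_univ' a]
    simp [sum_tmul, tmul_smul, smul_tmul']
  | add S T hS hT =>
    obtain ⟨s, rfl⟩ := hS
    obtain ⟨t, rfl⟩ := hT
    exact ⟨s + t, by simp [tmul_add, Finset.sum_add_distrib]⟩

/-- Every `3×3×3` complex tensor is a sum of at most `6` simple tensors. -/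
theorem tensor_333_max_rank_six
    (T : (Fin 3 → ℂ) ⊗[ℂ] ((Fin 3 → ℂ) ⊗[ℂ] (Fin 3 → ℂ))) :
    ∃ u v w : Fin 6 → (Fin 3 → ℂ),
      T = ∑ i : Fin 6, (u i) ⊗ₜ[ℂ] ((v i) ⊗ₜ[ℂ] (w i)) := by
  obtain ⟨t, rfl⟩ := exists_eq_sum_single_tmul T
  choose A hA using fun i => tensorOfMatrix_surjective (t i)
  obtain ⟨v, w, h⟩ := spannedByRankOnes_six (A 0) (A 1) (A 2)
  have hmem (i : Fin 3) : ∃ c : Fin 6 → ℂ, ∑ l, c l • vecMulVec (v l) (w l) = A i := by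
    rw [← Submodule.mem_span_range_iff_exists_fun]
    refine h (Submodule.subset_span ?_)
    fin_cases i <;> simp
  choose c hc using hmem
  refine ⟨fun l i => c i l, v, w, ?_⟩
  have ht (i : Fin 3) : t i = ∑ l, c i l • (v l ⊗ₜ[ℂ] w l) := by
    rw [← hA, ← hc]
    simp [tensorOfMatrix_vecMulVec]
  simp_rw [ht, tmul_sum]
  rw [Finset.sum_comm]
  refine Finset.sum_congr rfl fun l _ => ?_
  conv_rhs => rw [pi_eq_sum_univ' (fun i => c i l)]
  simp only [sum_tmul, smul_tmul]
end
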